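/- In the setting of the dyadic decomposition theorem (f ∈ BV(Q(0,1)) an NCBV map, ε > 0, 0 < α ≤ α₀ < ε, K = K(ε,α), K-dyadic squares {Q_i}, and F_{ε,K} the dyadic squares near F̃_ε), there exists a subcollection E_{ε,K} of F_{ε,K}, with union Ẽ_{ε,K}, such that |D^s f|(Q(0,1) \ Ẽ_{ε,K}) ≤ 2ε |D^s f|(Q(0,1)), and for every Q_i ∈ E_{ε,K} there exists a point w_i ∈ Q_i ∩ S such that ∫_{S ∩ 2Q_i} |g(z) − g(w_i)| d|D^s f|(z) ≤ ε |D^s f|(4Q_i ∩ S), where g ∈ L¹(|D^s f|, ℝ^{2×2}) is the polar decomposition density (g|D^s f| = D^s f), S = {x ∈ Q(0,1) : lim_{r→0} |Df|(Q(x,r))/r² = ∞}, and g(w_i) = u_i ⊗ v_i for suitable unit vectors u_i, v_i. -/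

import Mathlib

open MeasureTheory Set Filter Metric
open scoped ENNReal Topology RealInnerProductSpace NNReal

noncomputable section

/-- The Euclidean plane `ℝ²`. -/
abbrev E2 : Type := EuclideanSpace ℝ (Fin 2)

/-- The real inner product on `ℝ²`. -/
def rinner (x y : E2) : ℝ := ⟪x, y⟫

/-- The point of `ℝ²` with coordinates `x`, `y`. -/
def pt (x y : ℝ) : E2 := (WithLp.equiv 2 (Fin 2 → ℝ)).symm ![x, y]

/-- The open square `Q(c,r)` centred at `c` with side `2r`. -/
def osq (c : E2) (r : ℝ) : Set E2 := {p : E2 | ∀ i, |p i - c i| < r}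

/-- The closed square centred at `c` with side `2r`. -/
def csq (c : E2) (r : ℝ) : Set E2 := {p : E2 | ∀ i, |p i - c i| ≤ r}

/-- The unit square `Q(0,1) = (-1,1)²`. -/
def Q01 : Set E2 := osq 0 1

/-- First coordinate vector. -/
def e₀ : E2 := EuclideanSpace.single 0 1
/-- Second coordinate vector. -/
def e₁ : E2 := EuclideanSpace.single 1 1

/-- The rank-one matrix (tensor product) `u ⊗ v`, viewed as the linear map
`w ↦ ⟪v, w⟫ • u`. -/
def tensor (u v : E2) : E2 →L[ℝ] E2 := (innerSL ℝ v).smulRight u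

/-- A (representative of a) planar `BV` map on an open set `Ω ⊆ ℝ²`:  an integrable map `f`
together with a finite measure `var = |Df|` (the total variation of the distributional
derivative) carried by `Ω`, and the polar density `g` (with `‖g‖ = 1` `|Df|`-a.e. and
`Df = g |Df|`), linked to `f` by the integration-by-parts formula defining the
distributional derivative. -/
structure BVMap (Ω : Set E2) where
  f : E2 → E2
  integrable : MeasureTheory.IntegrableOn f Ω MeasureTheory.volume
  var : Measure E2
  var_finite : IsFiniteMeasure var
  var_outside : var Ωᶜ = 0
  g : E2 → (E2 →L[ℝ] E2)
  g_meas : AEStronglyMeasurable g var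
  g_norm : ∀ᵐ x ∂var, ‖g x‖ = 1
  int_by_parts : ∀ φ : E2 → ℝ, ContDiff ℝ 1 φ → HasCompactSupport φ →
    tsupport φ ⊆ Ω → ∀ (i j : Fin 2),
      ∫ x in Ω, f x i * (fderiv ℝ φ x (EuclideanSpace.single j 1)) ∂volume
        = - ∫ x, φ x * (g x (EuclideanSpace.single j 1) i) ∂var

namespace BVMap

variable {Ω : Set E2}

/-- The total variation `|D^a f|` of the absolutely continuous part of `Df`. -/
def varA (F : BVMap Ω) : Measure E2 := volume.withDensity (F.var.rnDeriv volume)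

/-- The total variation `|D^s f|` of the singular part of `Df`. -/
def varS (F : BVMap Ω) : Measure E2 := F.var.singularPart volume

/-- The approximate differential `∇f` of `f` (the density of `D^a f` w.r.t. Lebesgue
measure). -/
def aDeriv (F : BVMap Ω) (x : E2) : E2 →L[ℝ] E2 :=
  ((F.var.rnDeriv volume x).toReal) • F.g x

/-- The total variation `|⟨Df, v⟩|(A)` of the directional derivative measure
`⟨Df, v⟩ = (g v)|Df|` on `A`. -/
def dirVar (F : BVMap Ω) (v : E2) (A : Set E2) : ℝ≥0∞ := ∫⁻ x in A, ‖F.g x v‖₊ ∂F.var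

/-- `r⁻¹ |Df|(Q(X,r)) → 0` as `r → 0⁺`. -/
def SmallDeriv (F : BVMap Ω) (X : E2) : Prop :=
  Tendsto (fun r : ℝ => F.var (osq X r) / ENNReal.ofReal r) (𝓝[>] 0) (𝓝 0)

end BVMap

/-- `x` is an approximate jump point of `f` with one-sided limits `a`, `b` and
direction `ν`. -/
def ApproxJumpAt (f : E2 → E2) (x a b ν : E2) : Prop :=
  ‖ν‖ = 1 ∧ a ≠ b ∧
  Tendsto (fun r : ℝ => ⨍ y in {y ∈ ball x r | 0 < rinner (y - x) ν}, ‖f y - a‖ ∂volume)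
    (𝓝[>] 0) (𝓝 0) ∧
  Tendsto (fun r : ℝ => ⨍ y in {y ∈ ball x r | rinner (y - x) ν < 0}, ‖f y - b‖ ∂volume)
    (𝓝[>] 0) (𝓝 0)

/-- The approximate jump set `J_f` of `f`. -/
def Jset (f : E2 → E2) : Set E2 := {x | ∃ a b ν, ApproxJumpAt f x a b ν}

/-- `x` is a Lebesgue point of the jump part density `(f⁺-f⁻) ⊗ ν` with respect to
`H¹` restricted to `S` (here `jp, jm, ν` denote a choice of the jump data `f⁺, f⁻, ν`). -/
def JumpLebesguePointOn (S : Set E2) (jp jm ν : E2 → E2) (x : E2) : Prop :=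
  Tendsto (fun r : ℝ =>
      (∫ y in S ∩ ball x r,
          ‖tensor (jp y - jm y) (ν y) - tensor (jp x - jm x) (ν x)‖ ∂(μH[1])) / r)
    (𝓝[>] 0) (𝓝 0)

/-- A finitely piecewise linear injective curve `γ : [0,1] → ℝ²`, with its breakpoints
`t 0 = 0 < t 1 < ⋯ < t n = 1`. -/
structure PLCurve where
  n : ℕ
  γ : ℝ → E2
  t : Fin (n + 1) → ℝ
  t_mono : StrictMono t
  t_first : t 0 = 0
  t_last : t (Fin.last n) = 1
  affine : ∀ i : Fin n, ∀ s ∈ Icc (t i.castSucc) (t i.succ),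
    γ s = γ (t i.castSucc)
      + ((s - t i.castSucc) / (t i.succ - t i.castSucc)) • (γ (t i.succ) - γ (t i.castSucc))
  inj : InjOn γ (Icc 0 1)

/-- The image of a piecewise linear curve. -/
def PLCurve.im (c : PLCurve) : Set E2 := c.γ '' Icc 0 1

/-- The set covered by a grid of piecewise linear curves. -/
def gridSet {K : ℕ} (Γ : Fin K → PLCurve) : Set E2 := ⋃ i, (Γ i).im

/-- The grid `Γ` (a finite union of piecewise linear injective curves inside `Q(0,1)`,
any two meeting in at most one point) is admissible for `f`:  `f ∘ γᵢ` is one-dimensional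
`BV`, `f⌉Γ` is continuous at every breakpoint and every intersection point, and
`r⁻¹|Df|(Q(X,r)) → 0` at all those points. -/
def Admissible (F : BVMap Q01) {K : ℕ} (Γ : Fin K → PLCurve) : Prop :=
  (∀ i, MapsTo (Γ i).γ (Icc 0 1) Q01) ∧
  (∀ i j, i ≠ j → ((Γ i).im ∩ (Γ j).im).Subsingleton) ∧
  (∀ i, BoundedVariationOn (F.f ∘ (Γ i).γ) (Ioo 0 1)) ∧
  (∀ i (k : Fin ((Γ i).n + 1)),
    ContinuousWithinAt F.f (gridSet Γ) ((Γ i).γ ((Γ i).t k)) ∧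
      F.SmallDeriv ((Γ i).γ ((Γ i).t k))) ∧
  (∀ i j, i ≠ j → ∀ X ∈ (Γ i).im ∩ (Γ j).im,
    ContinuousWithinAt F.f (gridSet Γ) X ∧ F.SmallDeriv X)

/-- Full vertical segment `{x} × [-1,1]` of `Q(0,1)`. -/
def vline (x : ℝ) : Set E2 := {p : E2 | p 0 = x ∧ p 1 ∈ Icc (-1 : ℝ) 1}
/-- Full horizontal segment `[-1,1] × {y}` of `Q(0,1)`. -/
def hline (y : ℝ) : Set E2 := {p : E2 | p 1 = y ∧ p 0 ∈ Icc (-1 : ℝ) 1}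

/-- `jp, jm, ν` are jump data for `f` on the grid `Γ`, and every jump point of `f` on `Γ`
is a Lebesgue point of `(f⁺-f⁻) ⊗ ν` with respect to `H¹⌉J_f`. -/
def GridJumpData (F : BVMap Q01) {K : ℕ} (Γ : Fin K → PLCurve) (jp jm ν : E2 → E2) : Prop :=
  ∀ z ∈ gridSet Γ ∩ Jset F.f,
    ApproxJumpAt F.f z (jp z) (jm z) (ν z) ∧ JumpLebesguePointOn (Jset F.f) jp jm ν z

/-- A good straight grid for `f`: an admissible grid made of full vertical and horizontal
segments, on which every jump point of `f` is a Lebesgue point of `(f⁺-f⁻) ⊗ ν` with respect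
to `H¹⌉J_f`, the jump direction never being orthogonal to the grid line through the point. -/
def GoodStraightGrid (F : BVMap Q01) {K : ℕ} (Γ : Fin K → PLCurve) : Prop :=
  Admissible F Γ ∧
  (∀ i, (∃ x, (Γ i).im = vline x) ∨ (∃ y, (Γ i).im = hline y)) ∧
  ∃ jp jm ν : E2 → E2, GridJumpData F Γ jp jm ν ∧
    (∀ i x, (Γ i).im = vline x → ∀ z ∈ (Γ i).im ∩ Jset F.f, rinner e₁ (ν z) ≠ 0) ∧
    (∀ i y, (Γ i).im = hline y → ∀ z ∈ (Γ i).im ∩ Jset F.f, rinner e₀ (ν z) ≠ 0)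

/-- A good non-straight grid for `f`: an admissible grid on which every jump point of `f`
is a Lebesgue point of `(f⁺-f⁻) ⊗ ν` with respect to `H¹⌉J_f`, and the tangent `γᵢ'(t)`
exists and is not orthogonal to the jump direction at every jump point. -/
def GoodNonStraightGrid (F : BVMap Q01) {K : ℕ} (Γ : Fin K → PLCurve) : Prop :=
  Admissible F Γ ∧
  ∃ jp jm ν : E2 → E2, GridJumpData F Γ jp jm ν ∧
    ∀ i, ∀ s ∈ Icc (0:ℝ) 1, (Γ i).γ s ∈ Jset F.f →
      ∃ d : E2, HasDerivAt (Γ i).γ d s ∧ rinner d (ν ((Γ i).γ s)) ≠ 0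

/-- `h` is the geometric representative of `f` along the curve `γ` (defined on `[0,1]`):
denoting by `Y t`, `Z t` the one-sided limits of `f ∘ γ` at `t`, and by
`l t`, `L t` the variations of `f ∘ γ` on `[0,t)`, `[0,t]`, the filled-in curve `h̃`
parametrizes the segment `[Y t, Z t]` at constant speed on `[l t + t, L t + t]` and
`h (γ t) = h̃ ((1 + L 1) t)`. -/
def IsGeomRepOn (f : E2 → E2) (γ : ℝ → E2) (h : E2 → E2) : Prop :=
  ∃ (Y Z ht : ℝ → E2),
    (∀ t ∈ Ioc (0:ℝ) 1, Tendsto (f ∘ γ) (𝓝[<] t) (𝓝 (Y t))) ∧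
    (∀ t ∈ Ico (0:ℝ) 1, Tendsto (f ∘ γ) (𝓝[>] t) (𝓝 (Z t))) ∧
    (∀ t ∈ Icc (0:ℝ) 1, ∀ θ ∈ Icc (0:ℝ) 1,
      ht ((eVariationOn (f ∘ γ) (Ico 0 t)).toReal + t
          + θ * ((eVariationOn (f ∘ γ) (Icc 0 t)).toReal
              - (eVariationOn (f ∘ γ) (Ico 0 t)).toReal))
        = Y t + θ • (Z t - Y t)) ∧
    (∀ t ∈ Icc (0:ℝ) 1, h (γ t) = ht ((1 + (eVariationOn (f ∘ γ) (Icc 0 1)).toReal) * t))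

/-- `h` is the geometric representative of `f` on the grid `Γ`. -/
def IsGeomRep (F : BVMap Q01) {K : ℕ} (Γ : Fin K → PLCurve) (h : E2 → E2) : Prop :=
  ∀ i, IsGeomRepOn F.f (Γ i).γ h

/-- The no-crossing `BV` condition: on every good straight grid, the geometric
representative of `f` can be uniformly approximated by continuous injective maps. -/
def NCBV (F : BVMap Q01) : Prop :=
  ∀ σ : ℝ, 0 < σ → ∀ (K : ℕ) (Γ : Fin K → PLCurve), GoodStraightGrid F Γ →
    ∀ h : E2 → E2, IsGeomRep F Γ h →
      ∃ H : E2 → E2, ContinuousOn H (gridSet Γ) ∧ InjOn H (gridSet Γ) ∧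
        ∀ x ∈ gridSet Γ, ‖h x - H x‖ < σ

/-- The no-crossing `BV⁺` condition: on every good non-straight grid, the geometric
representative of `f` can be uniformly approximated by continuous injective maps. -/
def NCBVplus (F : BVMap Q01) : Prop :=
  ∀ σ : ℝ, 0 < σ → ∀ (K : ℕ) (Γ : Fin K → PLCurve), GoodNonStraightGrid F Γ →
    ∀ h : E2 → E2, IsGeomRep F Γ h →
      ∃ H : E2 → E2, ContinuousOn H (gridSet Γ) ∧ InjOn H (gridSet Γ) ∧
        ∀ x ∈ gridSet Γ, ‖h x - H x‖ < σ

/-- The matrix-valued measure `Df` evaluated on the set `A`. -/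
def DfSet (F : BVMap Q01) (A : Set E2) : E2 →L[ℝ] E2 := ∫ x in A, F.g x ∂F.var

/-- The matrix-valued measure `D^a f` evaluated on the set `A`. -/
def DafSet (F : BVMap Q01) (A : Set E2) : E2 →L[ℝ] E2 :=
  ∫ x in A, ((F.var.rnDeriv volume x).toReal) • F.g x ∂volume

/-- The total variation on `S` of a finitely additive matrix-valued set function, as the
supremum over finite disjoint families of measurable subsets of `S`. -/
def tvOn (m : Set E2 → (E2 →L[ℝ] E2)) (S : Set E2) : ℝ≥0∞ :=
  ⨆ (n : ℕ) (A : Fin n → Set E2) (_ : ∀ i, MeasurableSet (A i) ∧ A i ⊆ S)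
    (_ : Pairwise fun i j => Disjoint (A i) (A j)),
      ENNReal.ofReal (∑ i, ‖m (A i)‖)

/-- Area-strict convergence `f_k → f` on `Q(0,1)`:  `L¹` convergence, together with a
decomposition `Df_k = μ_k + ν_k` (as matrix-valued measures, here represented by densities
`m k`, `s k` with respect to finite measures `lam k`) such that `|μ_k - D^a f|(Q(0,1)) → 0`
and `|ν_k|(Q(0,1)) → |D^s f|(Q(0,1))`. -/
def AreaStrict (Fk : ℕ → BVMap Q01) (F : BVMap Q01) : Prop :=
  Tendsto (fun k => ∫ x in Q01, ‖(Fk k).f x - F.f x‖ ∂volume) atTop (𝓝 0) ∧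
  ∃ (lam : ℕ → Measure E2) (m s : ℕ → E2 → (E2 →L[ℝ] E2)),
    (∀ k, IsFiniteMeasure (lam k)) ∧
    (∀ k, Integrable (m k) (lam k)) ∧ (∀ k, Integrable (s k) (lam k)) ∧
    (∀ k (A : Set E2), MeasurableSet A →
      (∫ x in A, m k x ∂(lam k)) + (∫ x in A, s k x ∂(lam k)) = DfSet (Fk k) A) ∧
    Tendsto (fun k => tvOn (fun A => (∫ x in A, m k x ∂(lam k)) - DafSet F A) Q01)
      atTop (𝓝 0) ∧
    Tendsto (fun k => ∫⁻ x in Q01, ‖s k x‖₊ ∂(lam k)) atTop (𝓝 ((F.varS) Q01))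

/-- Weak `BV` convergence `f_k → f` on `Q(0,1)`: `L¹` convergence together with weak*
convergence of the derivative measures `Df_k → Df`. -/
def WeakBVTendsto (Fk : ℕ → BVMap Q01) (F : BVMap Q01) : Prop :=
  Tendsto (fun k => ∫ x in Q01, ‖(Fk k).f x - F.f x‖ ∂volume) atTop (𝓝 0) ∧
  ∀ φ : E2 → ℝ, Continuous φ → HasCompactSupport φ → tsupport φ ⊆ Q01 →
    ∀ i j : Fin 2,
      Tendsto (fun k => ∫ x, φ x * ((Fk k).g x (EuclideanSpace.single j 1) i) ∂(Fk k).var)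
        atTop (𝓝 (∫ x, φ x * (F.g x (EuclideanSpace.single j 1) i) ∂F.var))

/-- The `m`-strict energy `|D₁ f|(Q(0,1)) + |D₂ f|(Q(0,1))`. -/
def MStrictEnergy (F : BVMap Q01) : ℝ≥0∞ := F.dirVar e₀ Q01 + F.dirVar e₁ Q01

/-- `F` is a diffeomorphism of `Q(0,1)` onto itself equal to the identity on the
boundary. -/
def IsDiffeoQ (F : BVMap Q01) : Prop :=
  MapsTo F.f Q01 Q01 ∧ (∀ x ∈ frontier Q01, F.f x = x) ∧
  ContDiffOn ℝ 1 F.f Q01 ∧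
  ∃ Finv : E2 → E2, MapsTo Finv Q01 Q01 ∧ ContDiffOn ℝ 1 Finv Q01 ∧
    (∀ x ∈ Q01, Finv (F.f x) = x) ∧ (∀ y ∈ Q01, F.f (Finv y) = y)

/-- `F` is a homeomorphism of `Q(0,1)` onto itself equal to the identity on the
boundary. -/
def IsHomeoQ (F : BVMap Q01) : Prop :=
  MapsTo F.f Q01 Q01 ∧ (∀ x ∈ frontier Q01, F.f x = x) ∧
  ContinuousOn F.f Q01 ∧
  ∃ Finv : E2 → E2, MapsTo Finv Q01 Q01 ∧ ContinuousOn Finv Q01 ∧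
    (∀ x ∈ Q01, Finv (F.f x) = x) ∧ (∀ y ∈ Q01, F.f (Finv y) = y)

/-- The centre of the `K`-dyadic square of `Q(0,1)` with indices `a`, `b`. -/
def dyCenter (K : ℕ) (a b : Fin (2 ^ K)) : E2 :=
  pt (-1 + (2 * (a : ℝ) + 1) * (2 : ℝ) ^ (-(K : ℤ)))
     (-1 + (2 * (b : ℝ) + 1) * (2 : ℝ) ^ (-(K : ℤ)))

/-- The (closed) `K`-dyadic square of `Q(0,1)` with indices `a`, `b`; its side is
`2 · 2^{-K}`. -/
def dySq (K : ℕ) (a b : Fin (2 ^ K)) : Set E2 :=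
  csq (dyCenter K a b) ((2 : ℝ) ^ (-(K : ℤ)))

/-- The `K`-dyadic square with indices `a`, `b` intersects `T` or has a neighbouring
(touching) `K`-dyadic square intersecting `T`; this is the collection `F_{ε,K}` when
`T = F̃_ε`. -/
def InNearFam (K : ℕ) (T : Set E2) (a b : Fin (2 ^ K)) : Prop :=
  (dySq K a b ∩ T).Nonempty ∨
    ∃ a' b' : Fin (2 ^ K), (dySq K a' b' ∩ dySq K a b).Nonempty ∧ (dySq K a' b' ∩ T).Nonempty

/-- The union `F̃_{ε,K}` of the squares of the collection `F_{ε,K}`. -/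
def nearFamSet (K : ℕ) (T : Set E2) : Set E2 :=
  ⋃ (a : Fin (2 ^ K)) (b : Fin (2 ^ K)) (_ : InNearFam K T a b), dySq K a b

/-- The set `S` of points of infinite derivative density,
`S = {x ∈ Q(0,1) : lim_{r→0} |Df|(Q(x,r))/r² = ∞}`, which carries `D^s f`. -/
def Sset {Ω : Set E2} (F : BVMap Ω) : Set E2 :=
  {x ∈ Q01 | Tendsto (fun r : ℝ => F.var (osq x r) / ENNReal.ofReal (r ^ 2))
    (𝓝[>] 0) (𝓝 ⊤)}

/-- If the values taken by `h` on `G ⊆ [a, b]` cover `(h a, h b)`, then `[a, b] \ G` carries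
little of any nonnegative density close to `h'`. -/
theorem lintegral_diff_le_of_Ioo_subset_image {h h' σ : ℝ → ℝ}
    (hh : ∀ x, HasDerivAt h (h' x) x) (hc : Continuous h') (hσc : Continuous σ)
    (hσ : ∀ x, 0 ≤ σ x) {a b : ℝ} (hab : a ≤ b) {G : Set ℝ} (hG : MeasurableSet G)
    (hGab : G ⊆ Icc a b) (hcov : Ioo (h a) (h b) ⊆ h '' G) :
    ∫⁻ x in Icc a b \ G, ENNReal.ofReal (σ x)
      ≤ 2 * ∫⁻ x in Icc a b, ENNReal.ofReal |h' x - σ x| := by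
  set E := ∫⁻ x in Icc a b, ENNReal.ofReal |h' x - σ x| with hE
  have hi : ∀ {f : ℝ → ℝ}, Continuous f → IntegrableOn f (Icc a b) := fun hf =>
    hf.continuousOn.integrableOn_Icc
  have hvol : ENNReal.ofReal (h b - h a) ≤ ∫⁻ x in G, ENNReal.ofReal |h' x| := by
    have h1 := addHaar_image_le_lintegral_abs_det_fderiv (f := h) (s := G)
      (f' := fun x => ContinuousLinearMap.toSpanSingleton ℝ (h' x)) volume hG
      (fun x _ => (hh x).hasFDerivAt.hasFDerivWithinAt)
    simp only [ContinuousLinearMap.det_toSpanSingleton] at h1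
    calc ENNReal.ofReal (h b - h a) = volume (Ioo (h a) (h b)) := Real.volume_Ioo.symm
      _ ≤ volume (h '' G) := measure_mono hcov
      _ ≤ _ := h1
  have hvol2 : ∫⁻ x in G, ENNReal.ofReal |h' x| ≤ (∫⁻ x in G, ENNReal.ofReal (σ x)) + E := by
    calc ∫⁻ x in G, ENNReal.ofReal |h' x|
        ≤ ∫⁻ x in G, (ENNReal.ofReal (σ x) + ENNReal.ofReal |h' x - σ x|) := by
          refine lintegral_mono fun x => ?_
          rw [← ENNReal.ofReal_add (hσ x) (abs_nonneg _)]
          refine ENNReal.ofReal_le_ofReal ?_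
          calc |h' x| = |σ x + (h' x - σ x)| := by ring_nf
            _ ≤ |σ x| + |h' x - σ x| := abs_add_le _ _
            _ = _ := by rw [abs_of_nonneg (hσ x)]
      _ = (∫⁻ x in G, ENNReal.ofReal (σ x)) + ∫⁻ x in G, ENNReal.ofReal |h' x - σ x| :=
          lintegral_add_left (by fun_prop) _
      _ ≤ _ := by gcongr; exact lintegral_mono_set hGab
  have htot : ∫⁻ x in Icc a b, ENNReal.ofReal (σ x) ≤ ENNReal.ofReal (h b - h a) + E := by
    rw [hE, ← ofReal_integral_eq_lintegral_ofReal (hi hσc) (ae_of_all _ hσ),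
      ← ofReal_integral_eq_lintegral_ofReal (hi (by fun_prop)) (ae_of_all _ fun x => abs_nonneg _)]
    refine le_trans (ENNReal.ofReal_le_ofReal ?_) ENNReal.ofReal_add_le
    have hftc : ∫ x in Icc a b, h' x = h b - h a := by
      rw [integral_Icc_eq_integral_Ioc, ← intervalIntegral.integral_of_le hab]
      exact intervalIntegral.integral_eq_sub_of_hasDerivAt (fun x _ => hh x)
        (hc.intervalIntegrable _ _)
    rw [← hftc, ← integral_add (hi hc) (hi (by fun_prop))]
    refine integral_mono (hi hσc) (hi (by fun_prop)) fun x => ?_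
    have := neg_abs_le (h' x - σ x)
    simp only
    linarith
  have hsplit : ∫⁻ x in Icc a b, ENNReal.ofReal (σ x)
      = (∫⁻ x in G, ENNReal.ofReal (σ x)) + ∫⁻ x in Icc a b \ G, ENNReal.ofReal (σ x) := by
    rw [← lintegral_inter_add_sdiff _ (Icc a b) hG, inter_eq_self_of_subset_right hGab]
  have hfin : ∫⁻ x in G, ENNReal.ofReal (σ x) ≠ ∞ :=
    ((hi hσc).mono_set hGab).lintegral_lt_top.ne
  refine (ENNReal.add_le_add_iff_left hfin).1 ?_
  calc _ ≤ ENNReal.ofReal (h b - h a) + E := hsplit ▸ htot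
    _ ≤ ((∫⁻ x in G, ENNReal.ofReal (σ x)) + E) + E := by gcongr; exact hvol.trans hvol2
    _ = _ := by ring

theorem lintegral_diff_prefixMax_le {h h' σ : ℝ → ℝ}
    (hh : ∀ x, HasDerivAt h (h' x) x) (hc : Continuous h') (hσc : Continuous σ)
    (hσ : ∀ x, 0 ≤ σ x) {a b : ℝ} (hab : a ≤ b) :
    ∫⁻ x in Icc a b \ {x | ∀ y, a ≤ y → x ≤ y ∨ h y ≤ h x}, ENNReal.ofReal (σ x)
      ≤ 2 * ∫⁻ x in Icc a b, ENNReal.ofReal |h' x - σ x| := by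
  have hcont : Continuous h := continuous_iff_continuousAt.2 fun x => (hh x).continuousAt
  have hm : MeasurableSet {x | ∀ y, a ≤ y → x ≤ y ∨ h y ≤ h x} := by
    simp only [ofPred_forall, ofPred_or]
    exact (isClosed_iInter fun y => isClosed_iInter fun _ =>
      (isClosed_le continuous_id continuous_const).union
        (isClosed_le continuous_const hcont)).measurableSet
  rw [← sdiff_self_inter]
  refine lintegral_diff_le_of_Ioo_subset_image hh hc hσc hσ hab (measurableSet_Icc.inter hm)
    inter_subset_left fun t ht => ?_
  obtain ⟨x₀, hx₀, hmin⟩ : ∃ x₀, IsLeast (Icc a b ∩ h ⁻¹' Ici t) x₀ :=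
    (isCompact_Icc.inter_right (isClosed_Ici.preimage hcont)).exists_isLeast
      ⟨b, right_mem_Icc.2 hab, ht.2.le⟩
  have hlt : ∀ y, a ≤ y → y < x₀ → h y < t := fun y hay hy => by
    by_contra! hcon
    exact hy.not_ge (hmin ⟨⟨hay, hy.le.trans hx₀.1.2⟩, hcon⟩)
  have heq : h x₀ = t := by
    refine le_antisymm ?_ hx₀.2
    have hax : a < x₀ := lt_of_le_of_ne hx₀.1.1 fun hax => by
      have := hx₀.2
      rw [← hax] at this
      exact ht.1.not_ge this
    refine le_of_tendsto (hcont.continuousAt.tendsto.mono_left nhdsWithin_le_nhds)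
      (x := 𝓝[<] x₀) ?_
    filter_upwards [Ioo_mem_nhdsLT hax] with y hy using (hlt y hy.1.le hy.2).le
  refine ⟨x₀, ⟨hx₀.1, fun y hay => ?_⟩, heq⟩
  rcases le_or_gt x₀ y with h1 | h1
  · exact Or.inl h1
  · exact Or.inr (heq ▸ (hlt y hay h1).le)

theorem lintegral_diff_suffixMin_le {h h' σ : ℝ → ℝ}
    (hh : ∀ x, HasDerivAt h (h' x) x) (hc : Continuous h') (hσc : Continuous σ)
    (hσ : ∀ x, 0 ≤ σ x) {a b : ℝ} (hab : a ≤ b) :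
    ∫⁻ x in Icc a b \ {x | ∀ y, y ≤ b → y ≤ x ∨ h x ≤ h y}, ENNReal.ofReal (σ x)
      ≤ 2 * ∫⁻ x in Icc a b, ENNReal.ofReal |h' x - σ x| := by
  have hcont : Continuous h := continuous_iff_continuousAt.2 fun x => (hh x).continuousAt
  have hm : MeasurableSet {x | ∀ y, y ≤ b → y ≤ x ∨ h x ≤ h y} := by
    simp only [ofPred_forall, ofPred_or]
    exact (isClosed_iInter fun y => isClosed_iInter fun _ =>
      (isClosed_le continuous_const continuous_id).union
        (isClosed_le hcont continuous_const)).measurableSet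
  rw [← sdiff_self_inter]
  refine lintegral_diff_le_of_Ioo_subset_image hh hc hσc hσ hab (measurableSet_Icc.inter hm)
    inter_subset_left fun t ht => ?_
  obtain ⟨x₀, hx₀, hmax⟩ : ∃ x₀, IsGreatest (Icc a b ∩ h ⁻¹' Iic t) x₀ :=
    (isCompact_Icc.inter_right (isClosed_Iic.preimage hcont)).exists_isGreatest
      ⟨a, left_mem_Icc.2 hab, ht.1.le⟩
  have hlt : ∀ y, y ≤ b → x₀ < y → t < h y := fun y hyb hy => by
    by_contra! hcon
    exact hy.not_ge (hmax ⟨⟨hx₀.1.1.trans hy.le, hyb⟩, hcon⟩)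
  have heq : h x₀ = t := by
    refine le_antisymm hx₀.2 ?_
    have hxb : x₀ < b := lt_of_le_of_ne hx₀.1.2 fun hxb => by
      have := hx₀.2
      rw [hxb] at this
      exact ht.2.not_ge this
    refine ge_of_tendsto (hcont.continuousAt.tendsto.mono_left nhdsWithin_le_nhds)
      (x := 𝓝[>] x₀) ?_
    filter_upwards [Ioo_mem_nhdsGT hxb] with y hy using (hlt y hy.2.le hy.1).le
  refine ⟨x₀, ⟨hx₀.1, fun y hyb => ?_⟩, heq⟩
  rcases le_or_gt y x₀ with h1 | h1
  · exact Or.inl h1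
  · exact Or.inr (heq ▸ (hlt y hyb h1).le)

theorem setLIntegral_prod_diff_le {s t : Set ℝ} (hs : MeasurableSet s)
    {A : Set (ℝ × ℝ)} (hA : MeasurableSet A) {f k : ℝ × ℝ → ℝ≥0∞} (hf : Measurable f)
    (hk : Measurable k)
    (h : ∀ x ∈ s, ∫⁻ y in t \ {y | (x, y) ∈ A}, f (x, y) ≤ ∫⁻ y in t, k (x, y)) :
    ∫⁻ p in (s ×ˢ t) \ A, f p ≤ ∫⁻ p in s ×ˢ t, k p := by
  have h0 : ∫⁻ p in (s ×ˢ t) \ A, f p = ∫⁻ p in s ×ˢ t, Aᶜ.indicator f p := by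
    rw [lintegral_indicator hA.compl, Measure.restrict_restrict hA.compl, inter_comm, sdiff_eq]
  rw [h0, Measure.volume_eq_prod, setLIntegral_prod _ (hf.indicator hA.compl).aemeasurable,
    setLIntegral_prod _ hk.aemeasurable]
  refine setLIntegral_mono_ae' hs (ae_of_all _ fun x hx => ?_)
  have hAx : MeasurableSet {y | (x, y) ∈ A} := hA.preimage measurable_prodMk_left
  have h1 : ∀ y, Aᶜ.indicator f (x, y) = {y | (x, y) ∈ A}ᶜ.indicator (fun y => f (x, y)) y :=
    fun y => rfl
  simp_rw [h1]
  rw [lintegral_indicator hAx.compl, Measure.restrict_restrict hAx.compl, inter_comm, ← sdiff_eq]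
  exact h x hx

theorem setLIntegral_prod_diff_le_symm {s t : Set ℝ} (ht : MeasurableSet t)
    {A : Set (ℝ × ℝ)} (hA : MeasurableSet A) {f k : ℝ × ℝ → ℝ≥0∞} (hf : Measurable f)
    (hk : Measurable k)
    (h : ∀ y ∈ t, ∫⁻ x in s \ {x | (x, y) ∈ A}, f (x, y) ≤ ∫⁻ x in s, k (x, y)) :
    ∫⁻ p in (s ×ˢ t) \ A, f p ≤ ∫⁻ p in s ×ˢ t, k p := by
  have hsw : MeasurePreserving (Prod.swap : ℝ × ℝ → ℝ × ℝ) volume volume :=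
    Measure.measurePreserving_swap
  have hemb : MeasurableEmbedding (Prod.swap : ℝ × ℝ → ℝ × ℝ) :=
    MeasurableEquiv.prodComm.measurableEmbedding
  have key := setLIntegral_prod_diff_le ht (hA.preimage measurable_swap)
    (hf.comp measurable_swap) (hk.comp measurable_swap) h
  have e1 := hsw.setLIntegral_comp_preimage_emb hemb f ((s ×ˢ t) \ A)
  have e2 := hsw.setLIntegral_comp_preimage_emb hemb k (s ×ˢ t)
  rw [preimage_sdiff, preimage_swap_prod] at e1
  rw [preimage_swap_prod] at e2
  rw [← e1, ← e2]
  exact key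

theorem exists_setLIntegral_le_of_prod {a b : ℝ} (hab : a < b) {t : Set ℝ}
    {k : ℝ × ℝ → ℝ≥0∞} (hk : Measurable k) {M : ℝ} (hM : 0 < M)
    (h : ∫⁻ p in Icc a b ×ˢ t, k p ≤ ENNReal.ofReal M) :
    ∃ x ∈ Icc a b, ∫⁻ y in t, k (x, y) ≤ ENNReal.ofReal (2 * M / (b - a)) := by
  by_contra! hcon
  have hba : 0 < b - a := sub_pos.2 hab
  rw [Measure.volume_eq_prod, setLIntegral_prod _ hk.aemeasurable] at h
  have h1 : ∫⁻ x in Icc a b, ENNReal.ofReal (2 * M / (b - a)) ≤ ENNReal.ofReal M :=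
    (setLIntegral_mono_ae' measurableSet_Icc (ae_of_all _ fun x hx => (hcon x hx).le)).trans h
  rw [setLIntegral_const, Real.volume_Icc, ← ENNReal.ofReal_mul (by positivity),
    ENNReal.ofReal_le_ofReal_iff hM.le, div_mul_cancel₀ _ hba.ne'] at h1
  linarith

theorem abs_sub_le_of_setLIntegral_deriv_le {h h' : ℝ → ℝ} (hh : ∀ x, HasDerivAt h (h' x) x)
    (hc : Continuous h') {a b M : ℝ} (hM : 0 ≤ M)
    (hint : ∫⁻ x in Icc a b, ENNReal.ofReal |h' x| ≤ ENNReal.ofReal M) {x y : ℝ}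
    (hx : x ∈ Icc a b) (hy : y ∈ Icc a b) : |h x - h y| ≤ M := by
  rw [← intervalIntegral.integral_eq_sub_of_hasDerivAt (fun x _ => hh x)
    (hc.intervalIntegrable _ _), ← Real.norm_eq_abs]
  refine (intervalIntegral.norm_integral_le_integral_norm_uIoc).trans ?_
  have hi : IntegrableOn (fun x => |h' x|) (Icc a b) := hc.abs.continuousOn.integrableOn_Icc
  rw [← ofReal_integral_eq_lintegral_ofReal hi (ae_of_all _ fun x => abs_nonneg _),
    ENNReal.ofReal_le_ofReal_iff hM] at hint
  refine le_trans ?_ hint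
  refine setIntegral_mono_set hi (ae_of_all _ fun x => abs_nonneg _) (Eventually.of_forall ?_)
  exact uIoc_subset_uIcc.trans (uIcc_subset_Icc hy hx)

/-- The symmetric square `[-s, s]²`. -/
def symSq (s : ℝ) : Set (ℝ × ℝ) := Icc (-s) s ×ˢ Icc (-s) s

theorem measurableSet_symSq (s : ℝ) : MeasurableSet (symSq s) :=
  measurableSet_Icc.prod measurableSet_Icc

/-- A `C¹` function on the plane both of whose partial derivatives are `L¹`-close to a density
`σ ≥ 0` on a square is monotone and of controlled oscillation on a large part of the square. -/
theorem exists_monotone_part {u u₁ u₂ σ : ℝ × ℝ → ℝ}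
    (h₁ : ∀ x y, HasDerivAt (fun t => u (t, y)) (u₁ (x, y)) x)
    (h₂ : ∀ x y, HasDerivAt (fun t => u (x, t)) (u₂ (x, y)) y)
    (hu : Continuous u) (hu₁ : Continuous u₁) (hu₂ : Continuous u₂) (hσc : Continuous σ)
    (hσ : ∀ p, 0 ≤ σ p) {s m δ : ℝ} (hs : 0 < s) (hm : 0 < m) (hδ : δ ≤ 1)
    (hmass : ∫⁻ p in symSq s, ENNReal.ofReal (σ p) ≤ ENNReal.ofReal m)
    (he₁ : ∫⁻ p in symSq s, ENNReal.ofReal |u₁ p - σ p| ≤ ENNReal.ofReal (δ * m))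
    (he₂ : ∫⁻ p in symSq s, ENNReal.ofReal |u₂ p - σ p| ≤ ENNReal.ofReal (δ * m)) :
    ∃ G, MeasurableSet G ∧ G ⊆ symSq s ∧
      ∫⁻ p in symSq s \ G, ENNReal.ofReal (σ p) ≤ 8 * ENNReal.ofReal (δ * m) ∧
      (∀ p ∈ G, σ p / 2 ≤ u₁ p ∧ σ p / 2 ≤ u₂ p) ∧
      (∀ p ∈ G, ∀ x, x ≤ s → p.1 ≤ x → u p ≤ u (x, p.2)) ∧
      (∀ p ∈ G, ∀ y, -s ≤ y → y ≤ p.2 → u (p.1, y) ≤ u p) ∧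
      ∃ c, ∀ p ∈ G, p.1 ≤ s / 2 → -(s / 2) ≤ p.2 → |u p - c| ≤ 8 * m / s := by
  have hss : -s ≤ s := by linarith
  have hmR := measurableSet_symSq s
  set A₁ : Set (ℝ × ℝ) := {p | ∀ x, x ≤ s → x ≤ p.1 ∨ u p ≤ u (x, p.2)} with hA₁
  set A₂ : Set (ℝ × ℝ) := {p | ∀ y, -s ≤ y → p.2 ≤ y ∨ u (p.1, y) ≤ u p} with hA₂
  set B₁ : Set (ℝ × ℝ) := {p | σ p / 2 ≤ u₁ p} with hB₁
  set B₂ : Set (ℝ × ℝ) := {p | σ p / 2 ≤ u₂ p} with hB₂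
  have mA₁ : MeasurableSet A₁ := by
    simp only [hA₁, ofPred_forall, ofPred_or]
    exact (isClosed_iInter fun y => isClosed_iInter fun _ =>
      (isClosed_le continuous_const continuous_fst).union
        (isClosed_le hu (by fun_prop))).measurableSet
  have mA₂ : MeasurableSet A₂ := by
    simp only [hA₂, ofPred_forall, ofPred_or]
    exact (isClosed_iInter fun y => isClosed_iInter fun _ =>
      (isClosed_le continuous_snd continuous_const).union
        (isClosed_le (by fun_prop) hu)).measurableSet
  have mB₁ : MeasurableSet B₁ := (isClosed_le (by fun_prop) hu₁).measurableSet
  have mB₂ : MeasurableSet B₂ := (isClosed_le (by fun_prop) hu₂).measurableSet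
  have two : ∀ {w : ℝ × ℝ → ℝ}, Continuous w →
      ∫⁻ p in symSq s, ENNReal.ofReal |w p - σ p| ≤ ENNReal.ofReal (δ * m) →
      ∫⁻ p in symSq s, 2 * ENNReal.ofReal |w p - σ p| ≤ 2 * ENNReal.ofReal (δ * m) := by
    intro w hw h
    rw [lintegral_const_mul _ (by fun_prop)]
    gcongr
  have iA₁ : ∫⁻ p in symSq s \ A₁, ENNReal.ofReal (σ p) ≤ 2 * ENNReal.ofReal (δ * m) := by
    refine le_trans (setLIntegral_prod_diff_le_symm measurableSet_Icc mA₁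
      (by fun_prop) (by fun_prop) (k := fun p => 2 * ENNReal.ofReal |u₁ p - σ p|)
      fun y _ => ?_) (two hu₁ he₁)
    rw [lintegral_const_mul _ (by fun_prop)]
    exact lintegral_diff_suffixMin_le (h := fun t => u (t, y)) (h' := fun t => u₁ (t, y))
      (σ := fun t => σ (t, y)) (fun x => h₁ x y) (by fun_prop) (by fun_prop) (fun _ => hσ _) hss
  have iA₂ : ∫⁻ p in symSq s \ A₂, ENNReal.ofReal (σ p) ≤ 2 * ENNReal.ofReal (δ * m) := by
    refine le_trans (setLIntegral_prod_diff_le measurableSet_Icc mA₂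
      (by fun_prop) (by fun_prop) (k := fun p => 2 * ENNReal.ofReal |u₂ p - σ p|)
      fun x _ => ?_) (two hu₂ he₂)
    rw [lintegral_const_mul _ (by fun_prop)]
    exact lintegral_diff_prefixMax_le (h := fun t => u (x, t)) (h' := fun t => u₂ (x, t))
      (σ := fun t => σ (x, t)) (fun y => h₂ x y) (by fun_prop) (by fun_prop) (fun _ => hσ _) hss
  have iB : ∀ {w : ℝ × ℝ → ℝ}, Continuous w →
      ∫⁻ p in symSq s, ENNReal.ofReal |w p - σ p| ≤ ENNReal.ofReal (δ * m) →
      ∫⁻ p in symSq s \ {p | σ p / 2 ≤ w p}, ENNReal.ofReal (σ p)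
        ≤ 2 * ENNReal.ofReal (δ * m) := by
    intro w hw h
    have mB : MeasurableSet {p | σ p / 2 ≤ w p} := (isClosed_le (by fun_prop) hw).measurableSet
    refine le_trans (le_trans (setLIntegral_mono_ae' (hmR.diff mB) (ae_of_all _ fun p hp => ?_))
      (lintegral_mono_set sdiff_subset)) (two hw h)
    have hp2 : w p < σ p / 2 := not_le.1 hp.2
    have h2 : (2 : ℝ≥0∞) = ENNReal.ofReal 2 := by simp
    rw [h2, ← ENNReal.ofReal_mul zero_le_two]
    refine ENNReal.ofReal_le_ofReal ?_
    have := neg_abs_le (w p - σ p)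
    linarith
  have hint₂ : ∀ {w : ℝ × ℝ → ℝ}, Continuous w →
      ∫⁻ p in symSq s, ENNReal.ofReal |w p - σ p| ≤ ENNReal.ofReal (δ * m) →
      ∫⁻ p in symSq s, ENNReal.ofReal |w p| ≤ ENNReal.ofReal (2 * m) := by
    intro w hw h
    calc ∫⁻ p in symSq s, ENNReal.ofReal |w p|
        ≤ ∫⁻ p in symSq s, (ENNReal.ofReal (σ p) + ENNReal.ofReal |w p - σ p|) := by
          refine lintegral_mono fun p => ?_
          rw [← ENNReal.ofReal_add (hσ p) (abs_nonneg _)]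
          refine ENNReal.ofReal_le_ofReal ?_
          calc |w p| = |σ p + (w p - σ p)| := by ring_nf
            _ ≤ |σ p| + |w p - σ p| := abs_add_le _ _
            _ = _ := by rw [abs_of_nonneg (hσ p)]
      _ = _ := lintegral_add_left (by fun_prop) _
      _ ≤ ENNReal.ofReal m + ENNReal.ofReal m := by
          gcongr
          exact h.trans (ENNReal.ofReal_le_ofReal (by nlinarith))
      _ = _ := by rw [← ENNReal.ofReal_add hm.le hm.le]; ring_nf
  obtain ⟨X, hX, hXint⟩ := exists_setLIntegral_le_of_prod (a := s / 2) (b := s) (t := Icc (-s) s)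
    (k := fun p => ENNReal.ofReal |u₂ p|) (by linarith) (by fun_prop) (M := 2 * m) (by linarith)
    (le_trans (lintegral_mono_set (prod_mono (Icc_subset_Icc (by linarith) le_rfl) Subset.rfl))
      (hint₂ hu₂ he₂))
  obtain ⟨Y, hY, hYint⟩ := exists_setLIntegral_le_of_prod (a := -s) (b := -(s / 2))
    (t := Icc (-s) s) (k := fun p => ENNReal.ofReal |u₁ p.swap|) (by linarith) (by fun_prop)
    (M := 2 * m) (by linarith)
    (by
      have hsw : MeasurePreserving (Prod.swap : ℝ × ℝ → ℝ × ℝ) volume volume :=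
        Measure.measurePreserving_swap
      have hemb : MeasurableEmbedding (Prod.swap : ℝ × ℝ → ℝ × ℝ) :=
        MeasurableEquiv.prodComm.measurableEmbedding
      have e1 := hsw.setLIntegral_comp_preimage_emb hemb (fun p => ENNReal.ofReal |u₁ p|)
        (Icc (-s) s ×ˢ Icc (-s) (-(s / 2)))
      rw [preimage_swap_prod] at e1
      rw [e1]
      exact le_trans (lintegral_mono_set
        (prod_mono Subset.rfl (Icc_subset_Icc le_rfl (by linarith)))) (hint₂ hu₁ he₁))
  have e8 : 2 * (2 * m) / (s - s / 2) = 8 * m / s := by field_simp; ring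
  have e8' : 2 * (2 * m) / (-(s / 2) - -s) = 8 * m / s := by field_simp; ring
  rw [e8] at hXint
  rw [e8'] at hYint
  have h8 : 0 ≤ 8 * m / s := by positivity
  refine ⟨symSq s ∩ (A₁ ∩ A₂ ∩ (B₁ ∩ B₂)), hmR.inter ((mA₁.inter mA₂).inter (mB₁.inter mB₂)),
    inter_subset_left, ?_, fun p hp => hp.2.2, ?_, ?_, u (X, Y), ?_⟩
  · have hsub : symSq s \ (symSq s ∩ (A₁ ∩ A₂ ∩ (B₁ ∩ B₂))) ⊆
        ((symSq s \ A₁) ∪ (symSq s \ A₂)) ∪ ((symSq s \ B₁) ∪ (symSq s \ B₂)) := by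
      rw [sdiff_self_inter, sdiff_inter, sdiff_inter, sdiff_inter]
    refine (lintegral_mono_set hsub).trans ?_
    refine (lintegral_union_le _ _ _).trans ?_
    calc _ ≤ (2 * ENNReal.ofReal (δ * m) + 2 * ENNReal.ofReal (δ * m))
          + (2 * ENNReal.ofReal (δ * m) + 2 * ENNReal.ofReal (δ * m)) :=
          add_le_add ((lintegral_union_le _ _ _).trans (add_le_add iA₁ iA₂))
            ((lintegral_union_le _ _ _).trans (add_le_add (iB hu₁ he₁) (iB hu₂ he₂)))
      _ = _ := by ring
  · intro p hp x hx hpx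
    rcases hp.2.1.1 x hx with h | h
    · rw [← le_antisymm hpx h]
    · exact h
  · intro p hp y hy hpy
    rcases hp.2.1.2 y hy with h | h
    · rw [le_antisymm hpy h]
    · exact h
  · intro p hp hp1 hp2
    have hpR : p.1 ∈ Icc (-s) s ∧ p.2 ∈ Icc (-s) s := hp.1
    have r1 : u p ≤ u (X, p.2) := by
      rcases hp.2.1.1 X hX.2 with h | h
      · rw [show X = p.1 from le_antisymm h (hp1.trans hX.1)]
      · exact h
    have r2 : u (p.1, Y) ≤ u p := by
      rcases hp.2.1.2 Y hY.1 with h | h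
      · rw [show Y = p.2 from le_antisymm (hY.2.trans hp2) h]
      · exact h
    have r3 := abs_sub_le_of_setLIntegral_deriv_le (fun y => h₂ X y) (by fun_prop) h8 hXint
      hpR.2 (y := Y) ⟨hY.1, by linarith [hY.2]⟩
    have r4 := abs_sub_le_of_setLIntegral_deriv_le (fun x => h₁ x Y) (by fun_prop) h8 hYint
      hpR.1 (y := X) ⟨by linarith [hX.1], hX.2⟩
    rw [abs_le] at r3 r4 ⊢
    constructor <;> linarith

theorem ContinuousLinearMap.det_real_prod (L : (ℝ × ℝ) →L[ℝ] (ℝ × ℝ)) :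
    L.det = (L (1, 0)).1 * (L (0, 1)).2 - (L (0, 1)).1 * (L (1, 0)).2 := by
  change LinearMap.det (L : (ℝ × ℝ) →ₗ[ℝ] (ℝ × ℝ)) = _
  rw [← LinearMap.det_toMatrix (Module.Basis.finTwoProd ℝ), Matrix.det_fin_two]
  simp [LinearMap.toMatrix_apply]

theorem exists_monotone_part_of_contDiff {u σ : ℝ × ℝ → ℝ} (hu : ContDiff ℝ 1 u)
    (hσc : Continuous σ)
    (hσ : ∀ p, 0 ≤ σ p) {s m δ : ℝ} (hs : 0 < s) (hm : 0 < m) (hδ : δ ≤ 1)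
    (hmass : ∫⁻ p in symSq s, ENNReal.ofReal (σ p) ≤ ENNReal.ofReal m)
    (he₁ : ∫⁻ p in symSq s, ENNReal.ofReal |fderiv ℝ u p (1, 0) - σ p| ≤ ENNReal.ofReal (δ * m))
    (he₂ : ∫⁻ p in symSq s, ENNReal.ofReal |fderiv ℝ u p (0, 1) - σ p| ≤ ENNReal.ofReal (δ * m)) :
    ∃ G, MeasurableSet G ∧ G ⊆ symSq s ∧
      ∫⁻ p in symSq s \ G, ENNReal.ofReal (σ p) ≤ 8 * ENNReal.ofReal (δ * m) ∧
      (∀ p ∈ G, σ p / 2 ≤ fderiv ℝ u p (1, 0) ∧ σ p / 2 ≤ fderiv ℝ u p (0, 1)) ∧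
      (∀ p ∈ G, ∀ x, x ≤ s → p.1 ≤ x → u p ≤ u (x, p.2)) ∧
      (∀ p ∈ G, ∀ y, -s ≤ y → y ≤ p.2 → u (p.1, y) ≤ u p) ∧
      ∃ c, ∀ p ∈ G, p.1 ≤ s / 2 → -(s / 2) ≤ p.2 → |u p - c| ≤ 8 * m / s := by
  have hd : ∀ p, HasFDerivAt u (fderiv ℝ u p) p := fun p =>
    (hu.differentiable one_ne_zero p).hasFDerivAt
  have hc : Continuous (fderiv ℝ u) := hu.continuous_fderiv one_ne_zero
  refine exists_monotone_part (fun x y => ?_) (fun x y => ?_) hu.continuous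
    (by fun_prop) (by fun_prop) hσc hσ hs hm hδ hmass he₁ he₂
  · exact (hd (x, y)).comp_hasDerivAt x ((hasDerivAt_id x).prodMk (hasDerivAt_const x y))
  · exact (hd (x, y)).comp_hasDerivAt y ((hasDerivAt_const y x).prodMk (hasDerivAt_id y))

/-- If `∇u` is `L¹`-close to `(1, 1) σ` and `∇v` to `(1, -1) σ`, with `σ ≥ 0`, then `σ` cannot
concentrate on sets of small area. -/
theorem setLIntegral_le_of_gradients_close {u v σ : ℝ × ℝ → ℝ} (hu : ContDiff ℝ 1 u)
    (hv : ContDiff ℝ 1 v) (hσc : Continuous σ) (hσ : ∀ p, 0 ≤ σ p)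
    {s m δ : ℝ} (hs : 0 < s) (hm : 0 < m) (hδ : δ ≤ 1)
    (hmass : ∫⁻ p in symSq s, ENNReal.ofReal (σ p) ≤ ENNReal.ofReal m)
    (hu₁ : ∫⁻ p in symSq s, ENNReal.ofReal |fderiv ℝ u p (1, 0) - σ p| ≤ ENNReal.ofReal (δ * m))
    (hu₂ : ∫⁻ p in symSq s, ENNReal.ofReal |fderiv ℝ u p (0, 1) - σ p| ≤ ENNReal.ofReal (δ * m))
    (hv₁ : ∫⁻ p in symSq s, ENNReal.ofReal |fderiv ℝ v p (1, 0) - σ p| ≤ ENNReal.ofReal (δ * m))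
    (hv₂ : ∫⁻ p in symSq s, ENNReal.ofReal |fderiv ℝ v p (0, 1) + σ p| ≤ ENNReal.ofReal (δ * m))
    {A : Set (ℝ × ℝ)} (hAs : A ⊆ symSq (s / 2)) {l : ℝ} (hl : 0 < l) :
    ∫⁻ p in A, ENNReal.ofReal (σ p) ≤ ENNReal.ofReal l * volume A
      + ENNReal.ofReal (648 * m ^ 2 / (s ^ 2 * l)) + 16 * ENNReal.ofReal (δ * m) := by
  -- the reflection `(x, y) ↦ (x, -y)`
  let T : (ℝ × ℝ) →L[ℝ] (ℝ × ℝ) :=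
    (ContinuousLinearMap.fst ℝ ℝ ℝ).prod (-ContinuousLinearMap.snd ℝ ℝ ℝ)
  have hT : ∀ p, T p = (p.1, -p.2) := fun p => rfl
  have hTT : ∀ p, T (T p) = p := fun p => by simp [hT]
  have hTmp : MeasurePreserving T volume volume :=
    (MeasurePreserving.id volume).prod (Measure.measurePreserving_neg volume)
  have hTemb : MeasurableEmbedding T :=
    (MeasurableEquiv.ofInvolutive T hTT T.continuous.measurable).measurableEmbedding
  have hTS : T ⁻¹' symSq s = symSq s := by
    ext p
    simp only [symSq, mem_preimage, hT, mem_prod, mem_Icc]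
    constructor <;> rintro ⟨h1, h2, h3⟩ <;> exact ⟨h1, by linarith, by linarith⟩
  have hTint : ∀ k : ℝ × ℝ → ℝ≥0∞, ∫⁻ p in symSq s, k (T p) = ∫⁻ p in symSq s, k p := fun k => by
    have := hTmp.setLIntegral_comp_preimage_emb hTemb k (symSq s)
    rwa [hTS] at this
  have hvd : ∀ p, HasFDerivAt v (fderiv ℝ v p) p := fun p =>
    (hv.differentiable one_ne_zero p).hasFDerivAt
  have hud : ∀ p, HasFDerivAt u (fderiv ℝ u p) p := fun p =>
    (hu.differentiable one_ne_zero p).hasFDerivAt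
  have hwd : ∀ p, fderiv ℝ (v ∘ T) p = (fderiv ℝ v (T p)).comp T := fun p =>
    ((hvd (T p)).comp p T.hasFDerivAt).fderiv
  have hw1 : ∀ p, fderiv ℝ (v ∘ T) p (1, 0) = fderiv ℝ v (T p) (1, 0) := fun p => by
    rw [hwd]; simp [hT]
  have hw2 : ∀ p, fderiv ℝ (v ∘ T) p (0, 1) = -fderiv ℝ v (T p) (0, 1) := fun p => by
    rw [hwd, ← map_neg]; simp [hT]
  obtain ⟨G, mG, GS, Gint, Gder, Gr, Gc, c, Gosc⟩ :=
    exists_monotone_part_of_contDiff hu hσc hσ hs hm hδ hmass hu₁ hu₂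
  obtain ⟨H, mH, HS, Hint, Hder, Hr, Hc, d, Hosc⟩ :=
    exists_monotone_part_of_contDiff (u := v ∘ T) (σ := σ ∘ T) (hv.comp T.contDiff)
      (hσc.comp T.continuous) (fun p => hσ _) hs hm hδ
      ((hTint fun p => ENNReal.ofReal (σ p)).trans_le hmass)
      (by
        simp only [hw1]
        exact (hTint fun p => ENNReal.ofReal |fderiv ℝ v p (1, 0) - σ p|).trans_le hv₁)
      (by
        simp only [hw2]
        refine le_of_eq_of_le ?_ hv₂
        rw [← hTint fun p => ENNReal.ofReal |fderiv ℝ v p (0, 1) + σ p|]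
        refine lintegral_congr fun p => ?_
        rw [← abs_neg]
        simp only [Function.comp]
        ring_nf)
  set D := symSq (s / 2) ∩ (G ∩ T ⁻¹' H) with hD
  have mD : MeasurableSet D :=
    (measurableSet_symSq _).inter (mG.inter (mH.preimage T.continuous.measurable))
  have hHint : ∫⁻ p in symSq s \ T ⁻¹' H, ENNReal.ofReal (σ p) ≤ 8 * ENNReal.ofReal (δ * m) := by
    have := hTmp.setLIntegral_comp_preimage_emb hTemb (fun p => ENNReal.ofReal ((σ ∘ T) p))
      (symSq s \ H)
    rw [preimage_sdiff, hTS] at this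
    simp only [Function.comp, hTT] at this
    rw [this]
    exact Hint
  have hsmall : ∀ {p}, p ∈ symSq (s / 2) → p ∈ symSq s := fun {p} hp =>
    prod_mono (Icc_subset_Icc (by linarith) (by linarith))
      (Icc_subset_Icc (by linarith) (by linarith)) hp
  have hAD : ∫⁻ p in A \ D, ENNReal.ofReal (σ p) ≤ 16 * ENNReal.ofReal (δ * m) := by
    have hsub : A \ D ⊆ (symSq s \ G) ∪ (symSq s \ T ⁻¹' H) := by
      rw [← sdiff_inter]
      exact fun p hp => ⟨hsmall (hAs hp.1), fun h => hp.2 ⟨hAs hp.1, h⟩⟩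
    calc _ ≤ _ := lintegral_mono_set hsub
      _ ≤ _ := lintegral_union_le _ _ _
      _ ≤ 8 * ENNReal.ofReal (δ * m) + 8 * ENNReal.ofReal (δ * m) := add_le_add Gint hHint
      _ = _ := by ring
  set κ : ℝ := m / s ^ 2 with hκ
  have κpos : 0 < κ := by positivity
  -- strictly monotone perturbations of `u` and `v` are jointly injective on `D`
  let Φ : ℝ × ℝ → ℝ × ℝ := fun p => (u p + κ * (p.1 + p.2), v p + κ * (p.1 - p.2))
  let Φ' : ℝ × ℝ → (ℝ × ℝ) →L[ℝ] (ℝ × ℝ) := fun p =>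
    (fderiv ℝ u p + κ • (ContinuousLinearMap.fst ℝ ℝ ℝ + ContinuousLinearMap.snd ℝ ℝ ℝ)).prod
      (fderiv ℝ v p + κ • (ContinuousLinearMap.fst ℝ ℝ ℝ - ContinuousLinearMap.snd ℝ ℝ ℝ))
  have hΦ : ∀ p, HasFDerivAt Φ (Φ' p) p := fun p =>
    ((hud p).add ((hasFDerivAt_fst.add hasFDerivAt_snd).const_mul κ)).prodMk
      ((hvd p).add ((hasFDerivAt_fst.sub hasFDerivAt_snd).const_mul κ))
  have hinj : InjOn Φ D := by
    have key : ∀ p ∈ D, ∀ q ∈ D, p.1 ≤ q.1 → Φ p = Φ q → p = q := by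
      intro p hp q hq hpq heq
      have e1 : u p + κ * (p.1 + p.2) = u q + κ * (q.1 + q.2) := congrArg Prod.fst heq
      have e2 : v p + κ * (p.1 - p.2) = v q + κ * (q.1 - q.2) := congrArg Prod.snd heq
      have pS := GS hp.2.1
      have qS := GS hq.2.1
      rcases le_total p.2 q.2 with h | h
      · have a1 := Gr p hp.2.1 q.1 qS.1.2 hpq
        have a2 := Gc q hq.2.1 p.2 pS.2.1 h
        have : (q.1 - p.1) + (q.2 - p.2) ≤ 0 := by
          by_contra! hc
          nlinarith
        exact Prod.ext (by linarith) (by linarith)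
      · have a1 := Hr (T p) hp.2.2 q.1 qS.1.2 hpq
        have a2 := Hc (T q) hq.2.2 (-p.2) (neg_le_neg pS.2.2) (by simpa [hT] using h)
        simp only [Function.comp, hTT] at a1 a2
        simp only [hT, neg_neg] at a1 a2
        have : (q.1 - p.1) + (p.2 - q.2) ≤ 0 := by
          by_contra! hc
          nlinarith
        exact Prod.ext (by linarith) (by linarith)
    intro p hp q hq heq
    rcases le_total p.1 q.1 with h | h
    · exact key p hp q hq h heq
    · exact (key q hq p hp h heq.symm).symm
  have hdet : ∀ p ∈ D, σ p ^ 2 / 2 ≤ |(Φ' p).det| := by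
    intro p hp
    obtain ⟨g1, g2⟩ := Gder p hp.2.1
    obtain ⟨k1, k2⟩ := Hder (T p) hp.2.2
    rw [hw1, hTT] at k1
    rw [hw2, hTT] at k2
    simp only [Function.comp, hTT] at k1 k2
    rw [ContinuousLinearMap.det_real_prod, ← abs_neg]
    refine le_trans ?_ (le_abs_self _)
    have hσp := hσ p
    have e : -(((Φ' p) (1, 0)).1 * ((Φ' p) (0, 1)).2 - ((Φ' p) (0, 1)).1 * ((Φ' p) (1, 0)).2)
        = (fderiv ℝ u p (1, 0) + κ) * (-fderiv ℝ v p (0, 1) + κ)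
          + (fderiv ℝ u p (0, 1) + κ) * (fderiv ℝ v p (1, 0) + κ) := by
      simp [Φ']
      ring
    rw [e]
    have b1 : (σ p / 2) * (σ p / 2) ≤ (fderiv ℝ u p (1, 0) + κ) * (-fderiv ℝ v p (0, 1) + κ) :=
      mul_le_mul (by linarith) (by linarith) (by linarith) (by linarith)
    have b2 : (σ p / 2) * (σ p / 2) ≤ (fderiv ℝ u p (0, 1) + κ) * (fderiv ℝ v p (1, 0) + κ) :=
      mul_le_mul (by linarith) (by linarith) (by linarith) (by linarith)
    linarith
  have himg : Φ '' D ⊆ closedBall (c, d) (9 * m / s) := by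
    rintro _ ⟨p, hp, rfl⟩
    have hp1 : p.1 ∈ Icc (-(s / 2)) (s / 2) ∧ p.2 ∈ Icc (-(s / 2)) (s / 2) := hp.1
    have g := Gosc p hp.2.1 hp1.1.2 hp1.2.1
    have k := Hosc (T p) hp.2.2 hp1.1.2 (neg_le_neg hp1.2.2)
    simp only [Function.comp, hTT] at k
    have hκs : κ * s = m / s := by rw [hκ]; field_simp
    have e9 : 9 * m / s = 8 * m / s + κ * s := by rw [hκs]; ring
    obtain ⟨⟨x1, x2⟩, y1, y2⟩ := hp1
    have z1 : |κ * (p.1 + p.2)| ≤ κ * s := by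
      rw [abs_mul, abs_of_pos κpos]
      exact mul_le_mul_of_nonneg_left (abs_le.2 ⟨by linarith, by linarith⟩) κpos.le
    have z2 : |κ * (p.1 - p.2)| ≤ κ * s := by
      rw [abs_mul, abs_of_pos κpos]
      exact mul_le_mul_of_nonneg_left (abs_le.2 ⟨by linarith, by linarith⟩) κpos.le
    rw [mem_closedBall, Prod.dist_eq, max_le_iff, Real.dist_eq, Real.dist_eq, e9]
    constructor
    · calc |u p + κ * (p.1 + p.2) - c| = |(u p - c) + κ * (p.1 + p.2)| := by ring_nf
        _ ≤ _ := (abs_add_le _ _).trans (add_le_add g z1)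
    · calc |v p + κ * (p.1 - p.2) - d| = |(v p - d) + κ * (p.1 - p.2)| := by ring_nf
        _ ≤ _ := (abs_add_le _ _).trans (add_le_add k z2)
  have hsq : ∫⁻ p in D, ENNReal.ofReal (σ p ^ 2 / 2) ≤ ENNReal.ofReal (324 * m ^ 2 / s ^ 2) := by
    calc ∫⁻ p in D, ENNReal.ofReal (σ p ^ 2 / 2)
        ≤ ∫⁻ p in D, ENNReal.ofReal |(Φ' p).det| :=
          setLIntegral_mono_ae' mD (ae_of_all _ fun p hp => ENNReal.ofReal_le_ofReal (hdet p hp))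
      _ = volume (Φ '' D) := lintegral_abs_det_fderiv_eq_addHaar_image volume mD
          (fun p _ => (hΦ p).hasFDerivWithinAt) hinj
      _ ≤ volume (closedBall (c, d) (9 * m / s)) := measure_mono himg
      _ = _ := by
          rw [← closedBall_prod_same, Measure.volume_eq_prod, Measure.prod_prod,
            Real.volume_closedBall, Real.volume_closedBall, ← ENNReal.ofReal_mul (by positivity)]
          congr 1
          field_simp
          ring
  have hADi : ∫⁻ p in A ∩ D, ENNReal.ofReal (σ p) ≤ ENNReal.ofReal l * volume A
      + ENNReal.ofReal (648 * m ^ 2 / (s ^ 2 * l)) := by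
    calc ∫⁻ p in A ∩ D, ENNReal.ofReal (σ p)
        ≤ ∫⁻ p in A ∩ D, (ENNReal.ofReal l
            + ENNReal.ofReal (2 / l) * ENNReal.ofReal (σ p ^ 2 / 2)) := by
          refine lintegral_mono fun p => ?_
          rw [← ENNReal.ofReal_mul (by positivity), ← ENNReal.ofReal_add hl.le (by positivity)]
          refine ENNReal.ofReal_le_ofReal ?_
          have : 2 / l * (σ p ^ 2 / 2) = σ p ^ 2 / l := by field_simp
          rw [this]
          have h4 : l + σ p ^ 2 / l - σ p = ((l - σ p / 2) ^ 2 + 3 / 4 * σ p ^ 2) / l := by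
            field_simp
            ring
          have : 0 ≤ ((l - σ p / 2) ^ 2 + 3 / 4 * σ p ^ 2) / l := by positivity
          linarith
      _ = ENNReal.ofReal l * volume (A ∩ D)
            + ENNReal.ofReal (2 / l) * ∫⁻ p in A ∩ D, ENNReal.ofReal (σ p ^ 2 / 2) := by
          rw [lintegral_add_left (by fun_prop), setLIntegral_const,
            lintegral_const_mul _ (by fun_prop)]
      _ ≤ ENNReal.ofReal l * volume A
            + ENNReal.ofReal (2 / l) * ENNReal.ofReal (324 * m ^ 2 / s ^ 2) := by
          gcongr
          · exact inter_subset_left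
          · exact (lintegral_mono_set inter_subset_right).trans hsq
      _ = _ := by
          rw [← ENNReal.ofReal_mul (by positivity)]
          congr 2
          field_simp
          ring
  rw [← lintegral_inter_add_sdiff _ A mD]
  exact add_le_add hADi hAD

theorem symSq_eq_closedBall (s : ℝ) : symSq s = closedBall 0 s := by
  rw [show (0 : ℝ × ℝ) = (0, 0) from rfl, ← closedBall_prod_same, Real.closedBall_eq_Icc]
  simp [symSq]

theorem setLIntegral_le_of_gradients_close_closedBall {u v σ : ℝ × ℝ → ℝ} (x₀ : ℝ × ℝ)
    (hu : ContDiff ℝ 1 u) (hv : ContDiff ℝ 1 v) (hσc : Continuous σ) (hσ : ∀ p, 0 ≤ σ p)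
    {s m δ : ℝ} (hs : 0 < s) (hm : 0 < m) (hδ : δ ≤ 1)
    (hmass : ∫⁻ p in closedBall x₀ s, ENNReal.ofReal (σ p) ≤ ENNReal.ofReal m)
    (hu₁ : ∫⁻ p in closedBall x₀ s, ENNReal.ofReal |fderiv ℝ u p (1, 0) - σ p|
      ≤ ENNReal.ofReal (δ * m))
    (hu₂ : ∫⁻ p in closedBall x₀ s, ENNReal.ofReal |fderiv ℝ u p (0, 1) - σ p|
      ≤ ENNReal.ofReal (δ * m))
    (hv₁ : ∫⁻ p in closedBall x₀ s, ENNReal.ofReal |fderiv ℝ v p (1, 0) - σ p|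
      ≤ ENNReal.ofReal (δ * m))
    (hv₂ : ∫⁻ p in closedBall x₀ s, ENNReal.ofReal |fderiv ℝ v p (0, 1) + σ p|
      ≤ ENNReal.ofReal (δ * m))
    {A : Set (ℝ × ℝ)} (hAs : A ⊆ closedBall x₀ (s / 2)) {l : ℝ} (hl : 0 < l) :
    ∫⁻ p in A, ENNReal.ofReal (σ p) ≤ ENNReal.ofReal l * volume A
      + ENNReal.ofReal (648 * m ^ 2 / (s ^ 2 * l)) + 16 * ENNReal.ofReal (δ * m) := by
  have hmp : MeasurePreserving (fun p : ℝ × ℝ => x₀ + p) volume volume :=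
    measurePreserving_add_left volume x₀
  have hemb : MeasurableEmbedding (fun p : ℝ × ℝ => x₀ + p) := measurableEmbedding_addLeft x₀
  have hpre : ∀ r, (fun p : ℝ × ℝ => x₀ + p) ⁻¹' closedBall x₀ r = symSq r := fun r => by
    rw [symSq_eq_closedBall, preimage_add_closedBall, sub_self]
  have hint : ∀ (k : ℝ × ℝ → ℝ≥0∞) (r : ℝ),
      ∫⁻ p in symSq r, k (x₀ + p) = ∫⁻ p in closedBall x₀ r, k p := fun k r => by
    rw [← hpre, hmp.setLIntegral_comp_preimage_emb hemb k]
  have key := setLIntegral_le_of_gradients_close (u := fun p => u (x₀ + p))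
    (v := fun p => v (x₀ + p)) (σ := fun p => σ (x₀ + p)) (by fun_prop) (by fun_prop)
    (by fun_prop) (fun p => hσ _) hs hm hδ
    ((hint (fun p => ENNReal.ofReal (σ p)) s).trans_le hmass)
    (by
      simp only [fderiv_comp_add_left]
      exact (hint (fun p => ENNReal.ofReal |fderiv ℝ u p (1, 0) - σ p|) s).trans_le hu₁)
    (by
      simp only [fderiv_comp_add_left]
      exact (hint (fun p => ENNReal.ofReal |fderiv ℝ u p (0, 1) - σ p|) s).trans_le hu₂)
    (by
      simp only [fderiv_comp_add_left]
      exact (hint (fun p => ENNReal.ofReal |fderiv ℝ v p (1, 0) - σ p|) s).trans_le hv₁)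
    (by
      simp only [fderiv_comp_add_left]
      exact (hint (fun p => ENNReal.ofReal |fderiv ℝ v p (0, 1) + σ p|) s).trans_le hv₂)
    (A := (fun p : ℝ × ℝ => x₀ + p) ⁻¹' A) (by rw [← hpre]; exact preimage_mono hAs) hl
  rwa [hmp.measure_preimage_emb hemb,
    hmp.setLIntegral_comp_preimage_emb hemb (fun p => ENNReal.ofReal (σ p))] at key

theorem MeasureTheory.Integrable.mul_of_hasCompactSupport {μ : Measure (ℝ × ℝ)}
    {f k : ℝ × ℝ → ℝ} (hf : Integrable f μ) (hk : Continuous k) (hks : HasCompactSupport k) :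
    Integrable (fun p => f p * k p) μ := by
  obtain ⟨C, hC⟩ := hks.exists_bound_of_continuous hk
  exact hf.mul_bdd hk.aestronglyMeasurable (ae_of_all _ hC)

/-- `(w₁ μ, w₂ μ)` is the distributional gradient of `f` on `Ω ⊆ ℝ × ℝ`. -/
structure IsWeakGradient (Ω : Set (ℝ × ℝ)) (μ : Measure (ℝ × ℝ)) (f w₁ w₂ : ℝ × ℝ → ℝ) :
    Prop where
  integrable : Integrable f
  integrable₁ : Integrable w₁ μ
  integrable₂ : Integrable w₂ μ
  integral₁ : ∀ φ : ℝ × ℝ → ℝ, ContDiff ℝ 1 φ → HasCompactSupport φ → tsupport φ ⊆ Ω →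
    ∫ p, f p * fderiv ℝ φ p (1, 0) = -∫ p, φ p * w₁ p ∂μ
  integral₂ : ∀ φ : ℝ × ℝ → ℝ, ContDiff ℝ 1 φ → HasCompactSupport φ → tsupport φ ⊆ Ω →
    ∫ p, f p * fderiv ℝ φ p (0, 1) = -∫ p, φ p * w₂ p ∂μ

namespace IsWeakGradient

variable {Ω : Set (ℝ × ℝ)} {μ : Measure (ℝ × ℝ)} {f w₁ w₂ g z₁ z₂ : ℝ × ℝ → ℝ}

theorem linearCombination (hf : IsWeakGradient Ω μ f w₁ w₂) (hg : IsWeakGradient Ω μ g z₁ z₂)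
    (a b : ℝ) : IsWeakGradient Ω μ (fun p => a * f p + b * g p)
      (fun p => a * w₁ p + b * z₁ p) (fun p => a * w₂ p + b * z₂ p) := by
  have hder : ∀ {φ : ℝ × ℝ → ℝ} (e : ℝ × ℝ), ContDiff ℝ 1 φ → HasCompactSupport φ →
      Continuous (fun p => fderiv ℝ φ p e) ∧ HasCompactSupport (fun p => fderiv ℝ φ p e) :=
    fun e hφ hs => ⟨(hφ.continuous_fderiv one_ne_zero).clm_apply continuous_const,
      hs.fderiv_apply (𝕜 := ℝ) e⟩
  have key : ∀ {φ : ℝ × ℝ → ℝ} {w z : ℝ × ℝ → ℝ} (e : ℝ × ℝ), ContDiff ℝ 1 φ →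
      HasCompactSupport φ → Integrable w μ → Integrable z μ →
      ∫ p, f p * fderiv ℝ φ p e = -∫ p, φ p * w p ∂μ →
      ∫ p, g p * fderiv ℝ φ p e = -∫ p, φ p * z p ∂μ →
      ∫ p, (a * f p + b * g p) * fderiv ℝ φ p e = -∫ p, φ p * (a * w p + b * z p) ∂μ := by
    intro φ w z e hφ hs hw hz h1 h2
    obtain ⟨c1, c2⟩ := hder e hφ hs
    have e1 : ∀ p, (a * f p + b * g p) * fderiv ℝ φ p e
        = a * (f p * fderiv ℝ φ p e) + b * (g p * fderiv ℝ φ p e) := fun p => by ring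
    have e2 : ∀ p, φ p * (a * w p + b * z p) = a * (w p * φ p) + b * (z p * φ p) :=
      fun p => by ring
    simp_rw [e1, e2]
    rw [integral_add ((hf.integrable.mul_of_hasCompactSupport c1 c2).const_mul a)
        ((hg.integrable.mul_of_hasCompactSupport c1 c2).const_mul b),
      integral_add ((hw.mul_of_hasCompactSupport hφ.continuous hs).const_mul a)
        ((hz.mul_of_hasCompactSupport hφ.continuous hs).const_mul b)]
    simp_rw [integral_const_mul, h1, h2, mul_comm (w _), mul_comm (z _)]
    ring
  exact ⟨(hf.integrable.const_mul a).add (hg.integrable.const_mul b),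
    (hf.integrable₁.const_mul a).add (hg.integrable₁.const_mul b),
    (hf.integrable₂.const_mul a).add (hg.integrable₂.const_mul b),
    fun φ h1 h2 h3 => key _ h1 h2 hf.integrable₁ hg.integrable₁ (hf.integral₁ φ h1 h2 h3)
      (hg.integral₁ φ h1 h2 h3),
    fun φ h1 h2 h3 => key _ h1 h2 hf.integrable₂ hg.integrable₂ (hf.integral₂ φ h1 h2 h3)
      (hg.integral₂ φ h1 h2 h3)⟩

theorem exists_mollification (hf : IsWeakGradient Ω μ f w₁ w₂) {ρ : ℝ × ℝ → ℝ} {η : ℝ}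
    (hρ : ContDiff ℝ 1 ρ) (hsupp : tsupport ρ ⊆ closedBall 0 η) :
    ∃ u : ℝ × ℝ → ℝ, ContDiff ℝ 1 u ∧ ∀ x, closedBall x η ⊆ Ω →
      fderiv ℝ u x (1, 0) = ∫ y, ρ (x - y) * w₁ y ∂μ ∧
      fderiv ℝ u x (0, 1) = ∫ y, ρ (x - y) * w₂ y ∂μ := by
  have hcs : HasCompactSupport ρ := (isCompact_closedBall 0 η).of_isClosed_subset
    (isClosed_tsupport ρ) hsupp
  have hloc := hf.integrable.locallyIntegrable
  refine ⟨convolution ρ f (ContinuousLinearMap.mul ℝ ℝ) volume,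
    hcs.contDiff_convolution_left (n := 1) _ hρ hloc, fun x hx => ?_⟩
  have hφ : ContDiff ℝ 1 fun y => ρ (x - y) := by fun_prop
  have hφt : tsupport (fun y => ρ (x - y)) ⊆ closedBall x η := by
    refine closure_minimal (fun y hy => ?_) isClosed_closedBall
    have := hsupp (subset_tsupport ρ hy)
    rwa [mem_closedBall_zero_iff, ← dist_eq_norm, dist_comm] at this
  have hφc : HasCompactSupport fun y => ρ (x - y) := (isCompact_closedBall x η).of_isClosed_subset
    (isClosed_tsupport _) hφt
  have hfd : ∀ y e, fderiv ℝ (fun y => ρ (x - y)) y e = -fderiv ℝ ρ (x - y) e := fun y e => by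
    have h := ((hρ.differentiable one_ne_zero (x - y)).hasFDerivAt).comp y
      ((hasFDerivAt_id y).const_sub x)
    rw [show (fun y => ρ (x - y)) = ρ ∘ fun y => x - y from rfl, HasFDerivAt.fderiv h]
    simp
  have key : ∀ e, fderiv ℝ (convolution ρ f (ContinuousLinearMap.mul ℝ ℝ) volume) x e
      = -∫ y, f y * fderiv ℝ (fun y => ρ (x - y)) y e := by
    intro e
    rw [(hcs.hasFDerivAt_convolution_left (ContinuousLinearMap.mul ℝ ℝ) hρ hloc x).fderiv,
      convolution_eq_swap, ContinuousLinearMap.integral_apply, ← integral_neg]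
    · refine integral_congr_ae (ae_of_all _ fun y => ?_)
      simp [hfd, mul_comm]
    · have hce : ConvolutionExistsAt (fderiv ℝ ρ) f x
          (ContinuousLinearMap.precompL (ℝ × ℝ) (ContinuousLinearMap.mul ℝ ℝ)) volume :=
        (hcs.fderiv ℝ).convolutionExists_left _ (hρ.continuous_fderiv one_ne_zero) hloc x
      exact hce.integrable_swap
  constructor
  · rw [key, hf.integral₁ _ hφ hφc (hφt.trans hx), neg_neg]
  · rw [key, hf.integral₂ _ hφ hφc (hφt.trans hx), neg_neg]

end IsWeakGradient

theorem exists_mollifier {η : ℝ} (hη : 0 < η) : ∃ ρ : ℝ × ℝ → ℝ, ContDiff ℝ 1 ρ ∧ (∀ p, 0 ≤ ρ p) ∧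
    tsupport ρ ⊆ closedBall 0 η ∧ ∫⁻ p, ENNReal.ofReal (ρ p) = 1 := by
  let b : ContDiffBump (0 : ℝ × ℝ) := ⟨η / 2, η, half_pos hη, half_lt_self hη⟩
  refine ⟨b.normed volume, b.contDiff_normed, b.nonneg_normed, b.tsupport_normed_eq.subset, ?_⟩
  rw [← ofReal_integral_eq_lintegral_ofReal b.integrable_normed
    (ae_of_all _ b.nonneg_normed), b.integral_normed, ENNReal.ofReal_one]

theorem lintegral_mollified_le {μ : Measure (ℝ × ℝ)} [IsFiniteMeasure μ] {ρ : ℝ × ℝ → ℝ} {η : ℝ}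
    (hρ : Continuous ρ) (hsupp : tsupport ρ ⊆ closedBall 0 η)
    (hone : ∫⁻ p, ENNReal.ofReal (ρ p) = 1) {k : ℝ × ℝ → ℝ≥0∞} (hk : AEMeasurable k μ)
    (x₀ : ℝ × ℝ) (s : ℝ) :
    ∫⁻ x in closedBall x₀ s, ∫⁻ y, ENNReal.ofReal (ρ (x - y)) * k y ∂μ
      ≤ ∫⁻ y in closedBall x₀ (s + η), k y ∂μ := by
  rw [lintegral_lintegral_swap, ← lintegral_indicator measurableSet_closedBall]
  · refine lintegral_mono fun y => ?_
    rw [lintegral_mul_const _ (by fun_prop)]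
    by_cases hy : y ∈ closedBall x₀ (s + η)
    · rw [indicator_of_mem hy]
      refine mul_le_of_le_one_left' ((setLIntegral_le_lintegral _ _).trans ?_)
      rw [lintegral_sub_right_eq_self (fun x => ENNReal.ofReal (ρ x)), hone]
    · rw [indicator_of_notMem hy]
      refine le_of_eq (mul_eq_zero_of_left ?_ _)
      refine setLIntegral_eq_zero measurableSet_closedBall fun x hx => ?_
      have : ρ (x - y) = 0 := by
        refine image_eq_zero_of_notMem_tsupport fun h => hy ?_
        have h' := hsupp h
        rw [mem_closedBall_zero_iff, ← dist_eq_norm] at h'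
        rw [mem_closedBall] at hx ⊢
        linarith [dist_triangle_left y x₀ x]
      simp [this]
  · exact ((by fun_prop : Measurable fun p : (ℝ × ℝ) × (ℝ × ℝ) =>
      ENNReal.ofReal (ρ (p.1 - p.2))).aemeasurable).mul hk.comp_snd

theorem measure_le_lintegral_mollified {μ : Measure (ℝ × ℝ)} [IsFiniteMeasure μ]
    {ρ : ℝ × ℝ → ℝ} {η : ℝ} (hρ : Continuous ρ) (hsupp : tsupport ρ ⊆ closedBall 0 η)
    (hone : ∫⁻ p, ENNReal.ofReal (ρ p) = 1) {K : Set (ℝ × ℝ)} (hK : IsCompact K) :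
    μ K ≤ ∫⁻ x in cthickening η K, ∫⁻ y, ENNReal.ofReal (ρ (x - y)) ∂μ := by
  rw [lintegral_lintegral_swap (by fun_prop), ← lintegral_indicator_one hK.measurableSet]
  refine lintegral_mono fun y => ?_
  by_cases hy : y ∈ K
  · rw [indicator_of_mem hy, Pi.one_apply, ← hone,
      ← lintegral_sub_right_eq_self (fun x => ENNReal.ofReal (ρ x)) y,
      ← lintegral_indicator isClosed_cthickening.measurableSet]
    refine lintegral_mono fun x => ?_
    by_cases hx : x ∈ cthickening η K
    · rw [indicator_of_mem hx]
    · have : ρ (x - y) = 0 := by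
        refine image_eq_zero_of_notMem_tsupport fun h => hx ?_
        have h' := hsupp h
        rw [mem_closedBall_zero_iff, ← dist_eq_norm] at h'
        exact mem_cthickening_of_dist_le x y η K hy h'
      simp [this]
  · rw [indicator_of_notMem hy]
    exact zero_le

namespace IsWeakGradient

variable {Ω : Set (ℝ × ℝ)} {μ : Measure (ℝ × ℝ)} {f w₁ w₂ g z₁ z₂ : ℝ × ℝ → ℝ}

/-- If on a ball the gradients of `f` and `g` are close to `(1, 1) μ` and `(1, -1) μ` in total
variation, then `μ` is small on Lebesgue null sets. -/
theorem measure_le_of_null [IsFiniteMeasure μ] (hf : IsWeakGradient Ω μ f w₁ w₂)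
    (hg : IsWeakGradient Ω μ g z₁ z₂) {x₀ : ℝ × ℝ} {r δ : ℝ} (hr : 0 < r)
    (hΩ : closedBall x₀ r ⊆ Ω) (hδ : δ ≤ 1) (hpos : 0 < μ.real (closedBall x₀ r))
    (hw₁ : ∫⁻ y in closedBall x₀ r, ‖w₁ y - 1‖ₑ ∂μ
      ≤ ENNReal.ofReal (δ * μ.real (closedBall x₀ r)))
    (hw₂ : ∫⁻ y in closedBall x₀ r, ‖w₂ y - 1‖ₑ ∂μ
      ≤ ENNReal.ofReal (δ * μ.real (closedBall x₀ r)))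
    (hz₁ : ∫⁻ y in closedBall x₀ r, ‖z₁ y - 1‖ₑ ∂μ
      ≤ ENNReal.ofReal (δ * μ.real (closedBall x₀ r)))
    (hz₂ : ∫⁻ y in closedBall x₀ r, ‖z₂ y - (-1)‖ₑ ∂μ
      ≤ ENNReal.ofReal (δ * μ.real (closedBall x₀ r)))
    {K : Set (ℝ × ℝ)} (hK : IsCompact K) (hKr : K ⊆ closedBall x₀ (r / 8))
    (hK0 : volume K = 0) :
    μ K ≤ 16 * ENNReal.ofReal (δ * μ.real (closedBall x₀ r)) := by
  set m := μ.real (closedBall x₀ r) with hm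
  have main : ∀ l : ℝ, 0 < l → ∀ η ∈ Ioo 0 (r / 8), μ K ≤
      ENNReal.ofReal l * volume (cthickening η K)
        + ENNReal.ofReal (648 * m ^ 2 / ((r / 2) ^ 2 * l)) + 16 * ENNReal.ofReal (δ * m) := by
    intro l hl η ⟨hη, hηr⟩
    obtain ⟨ρ, hρ, hρ0, hsupp, hone⟩ := exists_mollifier hη
    have hcs : HasCompactSupport ρ := (isCompact_closedBall 0 η).of_isClosed_subset
      (isClosed_tsupport ρ) hsupp
    obtain ⟨C, hC⟩ := hcs.exists_bound_of_continuous hρ.continuous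
    obtain ⟨u, hu, hud⟩ := hf.exists_mollification hρ hsupp
    obtain ⟨v, hv, hvd⟩ := hg.exists_mollification hρ hsupp
    set σ : ℝ × ℝ → ℝ := fun x => ∫ y, ρ (x - y) ∂μ with hσ
    have hint : ∀ x, Integrable (fun y => ρ (x - y)) μ := fun x =>
      Integrable.of_bound (by fun_prop) C (ae_of_all _ fun y => hC _)
    have hσc : Continuous σ := continuous_of_dominated (fun x => (hint x).1)
      (fun x => ae_of_all _ fun y => hC _) (integrable_const C)
      (ae_of_all _ fun y => by fun_prop)
    have hσl : ∀ x, ENNReal.ofReal (σ x) = ∫⁻ y, ENNReal.ofReal (ρ (x - y)) ∂μ := fun x =>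
      ofReal_integral_eq_lintegral_ofReal (hint x) (ae_of_all _ fun y => hρ0 _)
    have hsub : ∀ x ∈ closedBall x₀ (r / 2), closedBall x η ⊆ Ω := fun x hx =>
      (closedBall_subset_closedBall' (by rw [mem_closedBall] at hx; linarith)).trans hΩ
    have hball : closedBall x₀ (r / 2 + η) ⊆ closedBall x₀ r :=
      closedBall_subset_closedBall (by linarith)
    have herr : ∀ {w : ℝ × ℝ → ℝ} (t : ℝ), Integrable w μ →
        ∫⁻ y in closedBall x₀ r, ‖w y - t‖ₑ ∂μ ≤ ENNReal.ofReal (δ * m) →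
        ∫⁻ x in closedBall x₀ (r / 2), ENNReal.ofReal |(∫ y, ρ (x - y) * w y ∂μ) - t * σ x|
          ≤ ENNReal.ofReal (δ * m) := by
      intro w t hw h
      have hk : AEMeasurable (fun y => ‖w y - t‖ₑ) μ :=
        (hw.1.sub aestronglyMeasurable_const).enorm
      refine le_trans (lintegral_mono fun x => ?_)
        ((lintegral_mollified_le hρ.continuous hsupp hone hk x₀ (r / 2)).trans
          ((lintegral_mono_set hball).trans h))
      have hwi : Integrable (fun y => ρ (x - y) * w y) μ :=
        hw.bdd_mul (hint x).1 (ae_of_all _ fun y => hC _)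
      have e1 : (∫ y, ρ (x - y) * w y ∂μ) - t * σ x = ∫ y, ρ (x - y) * (w y - t) ∂μ := by
        rw [hσ, ← integral_const_mul, ← integral_sub hwi ((hint x).const_mul t)]
        exact integral_congr_ae (ae_of_all _ fun y => by ring)
      rw [e1, ← Real.enorm_eq_ofReal_abs]
      refine (enorm_integral_le_lintegral_enorm _).trans (lintegral_mono fun y => ?_)
      rw [enorm_mul, Real.enorm_of_nonneg (hρ0 _)]
    have herr' : ∀ {w F : ℝ × ℝ → ℝ} (t : ℝ), Integrable w μ →
        (∀ x ∈ closedBall x₀ (r / 2), F x = ∫ y, ρ (x - y) * w y ∂μ) →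
        ∫⁻ y in closedBall x₀ r, ‖w y - t‖ₑ ∂μ ≤ ENNReal.ofReal (δ * m) →
        ∫⁻ x in closedBall x₀ (r / 2), ENNReal.ofReal |F x - t * σ x|
          ≤ ENNReal.ofReal (δ * m) := by
      intro w F t hw hF h
      refine le_of_eq_of_le (setLIntegral_congr_fun measurableSet_closedBall fun x hx => ?_)
        (herr t hw h)
      rw [hF x hx]
    have hmass : ∫⁻ p in closedBall x₀ (r / 2), ENNReal.ofReal (σ p) ≤ ENNReal.ofReal m := by
      have h1 := lintegral_mollified_le hρ.continuous hsupp hone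
        (aemeasurable_const (b := (1 : ℝ≥0∞)) (μ := μ)) x₀ (r / 2)
      simp only [mul_one, setLIntegral_one] at h1
      simp_rw [hσl]
      rw [hm, measureReal_def, ENNReal.ofReal_toReal (measure_ne_top _ _)]
      exact h1.trans (measure_mono hball)
    have hA : cthickening η K ⊆ closedBall x₀ (r / 2 / 2) := by
      refine (cthickening_subset_of_subset η hKr).trans ?_
      rw [cthickening_closedBall hη.le (by positivity)]
      exact closedBall_subset_closedBall (by linarith)
    have key := setLIntegral_le_of_gradients_close_closedBall x₀ hu hv hσc
      (fun p => integral_nonneg fun y => hρ0 _) (half_pos hr) hpos hδ hmass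
      (by simpa using herr' 1 hf.integrable₁ (fun x hx => (hud x (hsub x hx)).1) hw₁)
      (by simpa using herr' 1 hf.integrable₂ (fun x hx => (hud x (hsub x hx)).2) hw₂)
      (by simpa using herr' 1 hg.integrable₁ (fun x hx => (hvd x (hsub x hx)).1) hz₁)
      (by simpa using herr' (-1) hg.integrable₂ (fun x hx => (hvd x (hsub x hx)).2) hz₂)
      hA hl
    refine le_trans ?_ key
    simp_rw [hσl]
    exact measure_le_lintegral_mollified hρ.continuous hsupp hone hK
  have main2 : ∀ l : ℝ, 0 < l → μ K ≤
      ENNReal.ofReal (648 * m ^ 2 / ((r / 2) ^ 2 * l)) + 16 * ENNReal.ofReal (δ * m) := by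
    intro l hl
    have ht : Tendsto (fun η => ENNReal.ofReal l * volume (cthickening η K)
        + ENNReal.ofReal (648 * m ^ 2 / ((r / 2) ^ 2 * l)) + 16 * ENNReal.ofReal (δ * m))
        (𝓝[>] 0) (𝓝 (ENNReal.ofReal l * 0
        + ENNReal.ofReal (648 * m ^ 2 / ((r / 2) ^ 2 * l)) + 16 * ENNReal.ofReal (δ * m))) := by
      have h0 := (tendsto_measure_cthickening_of_isCompact (μ := volume) hK).mono_left
        (nhdsWithin_le_nhds (s := Ioi 0))
      rw [hK0] at h0
      exact ((ENNReal.Tendsto.const_mul h0 (Or.inr ENNReal.ofReal_ne_top)).add_const _).add_const _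
    rw [mul_zero, zero_add] at ht
    refine ge_of_tendsto ht ?_
    filter_upwards [Ioo_mem_nhdsGT (show (0 : ℝ) < r / 8 by positivity)] with η hη
      using main l hl η hη
  have ht : Tendsto (fun l : ℝ => ENNReal.ofReal (648 * m ^ 2 / ((r / 2) ^ 2 * l))
      + 16 * ENNReal.ofReal (δ * m)) atTop (𝓝 (ENNReal.ofReal 0 + 16 * ENNReal.ofReal (δ * m))) :=
    (ENNReal.tendsto_ofReal (tendsto_const_nhds.div_atTop
      (tendsto_id.const_mul_atTop (by positivity)))).add_const _
  rw [ENNReal.ofReal_zero, zero_add] at ht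
  refine ge_of_tendsto ht ?_
  filter_upwards [eventually_gt_atTop 0] with l hl using main2 l hl

end IsWeakGradient

theorem frequently_measure_closedBall_le {μ : Measure (ℝ × ℝ)} [IsFiniteMeasure μ] {x : ℝ × ℝ}
    (h : Tendsto (fun r => volume (closedBall x r) / μ (closedBall x r)) (𝓝[>] 0) (𝓝 0)) :
    ∃ᶠ r in 𝓝[>] (0 : ℝ), μ (closedBall x r) ≤ 64 * μ (closedBall x (r / 8)) := by
  intro hcon
  obtain ⟨r₀, hr₀, hr⟩ := mem_nhdsGT_iff_exists_Ioo_subset.1 hcon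
  replace hr₀ : 0 < r₀ := hr₀
  have hvol : ∀ r : ℝ, volume (closedBall x r) = 64 * volume (closedBall x (r / 8)) := by
    intro r
    rw [← Prod.mk.eta (p := x), ← closedBall_prod_same, ← closedBall_prod_same,
      Measure.volume_eq_prod, Measure.prod_prod, Measure.prod_prod]
    simp only [Real.volume_closedBall]
    rw [show 2 * r = 8 * (2 * (r / 8)) by ring, ENNReal.ofReal_mul (p := 8) (by norm_num),
      show ENNReal.ofReal 8 = 8 by norm_num, show (64 : ℝ≥0∞) = 8 * 8 by norm_num]
    ring
  have hstep : ∀ r ∈ Ioo 0 r₀, volume (closedBall x r) / μ (closedBall x r)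
      ≤ volume (closedBall x (r / 8)) / μ (closedBall x (r / 8)) := by
    intro r hrr
    have h1 : 64 * μ (closedBall x (r / 8)) ≤ μ (closedBall x r) := (not_le.1 (hr hrr)).le
    rw [hvol r]
    exact (ENNReal.div_le_div_left h1 _).trans_eq
      (ENNReal.mul_div_mul_left _ _ (by norm_num) (by norm_num))
  have hmem : ∀ k : ℕ, r₀ / 2 / 8 ^ k ∈ Ioo 0 r₀ := by
    intro k
    have h8 : (1 : ℝ) ≤ 8 ^ k := one_le_pow₀ (by norm_num)
    refine ⟨by positivity, ?_⟩
    rw [div_lt_iff₀ (by positivity)]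
    nlinarith
  have hiter : ∀ k : ℕ, volume (closedBall x (r₀ / 2)) / μ (closedBall x (r₀ / 2))
      ≤ volume (closedBall x (r₀ / 2 / 8 ^ k)) / μ (closedBall x (r₀ / 2 / 8 ^ k)) := by
    intro k
    induction k with
    | zero => simp
    | succ k ih =>
      refine ih.trans ((hstep _ (hmem k)).trans_eq ?_)
      rw [div_div _ _ (8 : ℝ), ← pow_succ]
  have hlim : Tendsto (fun k : ℕ => r₀ / 2 / 8 ^ k) atTop (𝓝[>] 0) := by
    refine tendsto_nhdsWithin_iff.2 ⟨?_, Eventually.of_forall fun k => (hmem k).1⟩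
    simpa [div_eq_mul_inv] using
      (tendsto_pow_atTop_nhds_zero_of_lt_one (r := (8 : ℝ)⁻¹) (by norm_num)
        (by norm_num)).const_mul (r₀ * 2⁻¹)
  have h0 := le_antisymm (ge_of_tendsto' (h.comp hlim) hiter) zero_le
  rw [ENNReal.div_eq_zero_iff] at h0
  exact h0.elim (measure_closedBall_pos volume x (by positivity)).ne' (measure_ne_top μ _)

theorem eventually_lintegral_linearCombination_sub_le {μ : Measure (ℝ × ℝ)} [IsFiniteMeasure μ]
    {p q : ℝ × ℝ → ℝ} (hp : Integrable p μ) {x : ℝ × ℝ}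
    (hpx : Tendsto (fun r => (∫⁻ y in closedBall x r, ‖p y - p x‖ₑ ∂μ) / μ (closedBall x r))
      (𝓝[>] 0) (𝓝 0))
    (hqx : Tendsto (fun r => (∫⁻ y in closedBall x r, ‖q y - q x‖ₑ ∂μ) / μ (closedBall x r))
      (𝓝[>] 0) (𝓝 0))
    {a b c δ : ℝ} (hc : a * p x + b * q x = c) (hδ : 0 < δ) :
    ∀ᶠ r in 𝓝[>] 0, ∫⁻ y in closedBall x r, ‖a * p y + b * q y - c‖ₑ ∂μ
      ≤ ENNReal.ofReal (δ * μ.real (closedBall x r)) := by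
  have hlim : Tendsto (fun r =>
      ‖a‖ₑ * ((∫⁻ y in closedBall x r, ‖p y - p x‖ₑ ∂μ) / μ (closedBall x r))
        + ‖b‖ₑ * ((∫⁻ y in closedBall x r, ‖q y - q x‖ₑ ∂μ) / μ (closedBall x r)))
      (𝓝[>] 0) (𝓝 0) := by
    simpa using (ENNReal.Tendsto.const_mul hpx (Or.inr enorm_ne_top)).add
      (ENNReal.Tendsto.const_mul hqx (Or.inr enorm_ne_top))
  filter_upwards [hlim.eventually_le_const (ENNReal.ofReal_pos.2 hδ)] with r hr
  rcases eq_or_ne (μ (closedBall x r)) 0 with h0 | h0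
  · rw [setLIntegral_measure_zero _ _ h0]
    exact zero_le
  have hpm : AEMeasurable (fun y => ‖a‖ₑ * ‖p y - p x‖ₑ) (μ.restrict (closedBall x r)) :=
    ((hp.1.restrict.sub aestronglyMeasurable_const).enorm).const_mul _
  calc ∫⁻ y in closedBall x r, ‖a * p y + b * q y - c‖ₑ ∂μ
      ≤ ∫⁻ y in closedBall x r, (‖a‖ₑ * ‖p y - p x‖ₑ + ‖b‖ₑ * ‖q y - q x‖ₑ) ∂μ := by
        refine lintegral_mono fun y => ?_
        rw [← enorm_mul, ← enorm_mul,
          show a * p y + b * q y - c = a * (p y - p x) + b * (q y - q x) by rw [← hc]; ring]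
        exact enorm_add_le _ _
    _ = ‖a‖ₑ * (∫⁻ y in closedBall x r, ‖p y - p x‖ₑ ∂μ)
        + ‖b‖ₑ * ∫⁻ y in closedBall x r, ‖q y - q x‖ₑ ∂μ := by
        rw [lintegral_add_left' hpm, lintegral_const_mul' _ _ enorm_ne_top,
          lintegral_const_mul' _ _ enorm_ne_top]
    _ ≤ ENNReal.ofReal δ * μ (closedBall x r) := by
        rw [← mul_div_assoc, ← mul_div_assoc, ENNReal.div_add_div_same] at hr
        exact (ENNReal.div_le_iff h0 (measure_ne_top μ _)).1 hr
    _ = ENNReal.ofReal (δ * μ.real (closedBall x r)) := by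
        rw [ENNReal.ofReal_mul hδ.le, ofReal_measureReal]

namespace IsWeakGradient

variable {Ω : Set (ℝ × ℝ)} {μ : Measure (ℝ × ℝ)} {f w₁ w₂ g z₁ z₂ : ℝ × ℝ → ℝ}

/-- The planar rank-one theorem: on a Lebesgue-null set the gradients of two functions of bounded
variation are parallel. -/
theorem ae_det_eq_zero [IsFiniteMeasure μ] (hΩ : IsOpen Ω) (hf : IsWeakGradient Ω μ f w₁ w₂)
    (hg : IsWeakGradient Ω μ g z₁ z₂) {N : Set (ℝ × ℝ)} (hN : MeasurableSet N)
    (hN0 : volume N = 0) :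
    ∀ᵐ x ∂μ.restrict N, x ∈ Ω → w₁ x * z₂ x - w₂ x * z₁ x = 0 := by
  have hleb : ∀ {w : ℝ × ℝ → ℝ}, Integrable w μ → ∀ᵐ x ∂μ.restrict N,
      Tendsto (fun r => (∫⁻ y in closedBall x r, ‖w y - w x‖ₑ ∂μ) / μ (closedBall x r))
        (𝓝[>] 0) (𝓝 0) := by
    intro w hw
    filter_upwards [ae_restrict_of_ae ((Besicovitch.vitaliFamily μ).ae_tendsto_lintegral_enorm_sub_div
      hw.locallyIntegrable)] with x hx
    exact hx.comp (Besicovitch.tendsto_filterAt μ x)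
  have hrn : ∀ᵐ x ∂μ.restrict N, (volume : Measure (ℝ × ℝ)).rnDeriv μ x = 0 := by
    have h0 : ∫⁻ x in N, (volume : Measure (ℝ × ℝ)).rnDeriv μ x ∂μ = 0 :=
      le_antisymm ((Measure.setLIntegral_rnDeriv_le N).trans_eq hN0) zero_le
    exact (lintegral_eq_zero_iff (Measure.measurable_rnDeriv _ _)).1 h0
  filter_upwards [hleb hf.integrable₁, hleb hf.integrable₂, hleb hg.integrable₁,
    hleb hg.integrable₂, hrn, Besicovitch.ae_tendsto_measure_inter_div μ N,
    ae_restrict_of_ae (Besicovitch.ae_tendsto_rnDeriv volume μ)]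
    with x hw₁ hw₂ hz₁ hz₂ hx0 hdens hvol hxΩ
  by_contra hd
  set d := w₁ x * z₂ x - w₂ x * z₁ x with hddef
  rw [hx0] at hvol
  have hu := hf.linearCombination hg ((z₂ x - z₁ x) / d) ((w₁ x - w₂ x) / d)
  have hv := hf.linearCombination hg ((z₂ x + z₁ x) / d) (-(w₁ x + w₂ x) / d)
  have hδ : (0 : ℝ) < 1 / 4096 := by norm_num
  have e₁ := eventually_lintegral_linearCombination_sub_le hf.integrable₁ hw₁ hz₁
    (a := (z₂ x - z₁ x) / d) (b := (w₁ x - w₂ x) / d) (c := 1)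
    (by field_simp; rw [hddef]; ring) hδ
  have e₂ := eventually_lintegral_linearCombination_sub_le hf.integrable₂ hw₂ hz₂
    (a := (z₂ x - z₁ x) / d) (b := (w₁ x - w₂ x) / d) (c := 1)
    (by field_simp; rw [hddef]; ring) hδ
  have e₃ := eventually_lintegral_linearCombination_sub_le hf.integrable₁ hw₁ hz₁
    (a := (z₂ x + z₁ x) / d) (b := -(w₁ x + w₂ x) / d) (c := 1)
    (by field_simp; rw [hddef]; ring) hδ
  have e₄ := eventually_lintegral_linearCombination_sub_le hf.integrable₂ hw₂ hz₂
    (a := (z₂ x + z₁ x) / d) (b := -(w₁ x + w₂ x) / d) (c := -1)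
    (by field_simp; rw [hddef]; ring) hδ
  have e₅ : ∀ᶠ r in 𝓝[>] (0 : ℝ), closedBall x r ⊆ Ω := by
    obtain ⟨r, hr, hrΩ⟩ := Metric.isOpen_iff.1 hΩ x hxΩ
    filter_upwards [Ioo_mem_nhdsGT hr] with s hs
    exact (closedBall_subset_ball hs.2).trans hrΩ
  have h8 : Tendsto (fun r : ℝ => r / 8) (𝓝[>] 0) (𝓝[>] 0) := by
    refine tendsto_nhdsWithin_iff.2 ⟨?_, ?_⟩
    · exact ((continuous_id.div_const 8).tendsto' (0 : ℝ) 0 (by simp)).mono_left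
        nhdsWithin_le_nhds
    · filter_upwards [self_mem_nhdsWithin] with r hr
      exact div_pos (mem_Ioi.1 hr) (by norm_num : (0 : ℝ) < 8)
  have e₆ := (hdens.comp h8).eventually_const_lt (u := 2⁻¹) (by simp)
  obtain ⟨r, hdbl, e₁, e₂, e₃, e₄, hrΩ, hhalf, hr⟩ :=
    ((frequently_measure_closedBall_le hvol).and_eventually
      (e₁.and (e₂.and (e₃.and (e₄.and (e₅.and (e₆.and self_mem_nhdsWithin))))))).exists
  replace hr : 0 < r := hr
  simp only [Function.comp_apply] at hhalf
  have hm8 : μ (closedBall x (r / 8)) ≠ 0 := by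
    intro h0
    rw [measure_mono_null inter_subset_right h0, ENNReal.zero_div] at hhalf
    exact not_lt_zero hhalf
  rw [ENNReal.lt_div_iff_mul_lt (Or.inl hm8) (Or.inl (measure_ne_top μ _))] at hhalf
  have hpos : 0 < μ.real (closedBall x r) := by
    rw [measureReal_def, ENNReal.toReal_pos_iff]
    exact ⟨(pos_iff_ne_zero.2 hm8).trans_le
      (measure_mono (closedBall_subset_closedBall (by linarith))), measure_lt_top μ _⟩
  obtain ⟨K, hKsub, hK, hμK⟩ :=
    (hN.inter measurableSet_closedBall).exists_lt_isCompact (μ := μ) hhalf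
  have hbound := measure_le_of_null hu hv hr hrΩ (δ := 1 / 4096) (by norm_num) hpos e₁ e₂ e₃
    (by simpa using e₄) hK (hKsub.trans inter_subset_right)
    (measure_mono_null (hKsub.trans inter_subset_left) hN0)
  have hlt := hμK.trans_le hbound
  rw [← ofReal_measureReal (μ := μ) (s := closedBall x (r / 8)),
    show (2⁻¹ : ℝ≥0∞) = ENNReal.ofReal 2⁻¹ by
      rw [ENNReal.ofReal_inv_of_pos (by norm_num)]; norm_num,
    ← ENNReal.ofReal_mul (by norm_num), show (16 : ℝ≥0∞) = ENNReal.ofReal 16 by norm_num,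
    ← ENNReal.ofReal_mul (by norm_num), ENNReal.ofReal_lt_ofReal_iff_of_nonneg (by positivity)]
    at hlt
  have hdbl' : μ.real (closedBall x r) ≤ 64 * μ.real (closedBall x (r / 8)) := by
    have := ENNReal.toReal_mono
      (ENNReal.mul_ne_top (by norm_num) (measure_ne_top μ (closedBall x (r / 8)))) hdbl
    simpa [measureReal_def] using this
  linarith

end IsWeakGradient

/-- The coordinate isomorphism from `E2` to `ℝ × ℝ`. -/
def planeEquiv : E2 ≃L[ℝ] ℝ × ℝ :=
  (EuclideanSpace.equiv (Fin 2) ℝ).trans (ContinuousLinearEquiv.finTwoArrow ℝ ℝ)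

theorem planeEquiv_apply (x : E2) : planeEquiv x = (x 0, x 1) := rfl

theorem measurePreserving_planeEquiv : MeasurePreserving planeEquiv volume volume :=
  (volume_preserving_finTwoArrow ℝ).comp (PiLp.volume_preserving_ofLp (Fin 2))

theorem measurableEmbedding_planeEquiv : MeasurableEmbedding planeEquiv :=
  planeEquiv.toHomeomorph.measurableEmbedding

theorem planeEquiv_preimage_closedBall (x : E2) {r : ℝ} :
    planeEquiv ⁻¹' closedBall (planeEquiv x) r = csq x r := by
  ext y
  simp [planeEquiv_apply, csq, Prod.dist_eq, Real.dist_eq, Fin.forall_fin_two]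

theorem planeEquiv_preimage_ball (x : E2) {r : ℝ} :
    planeEquiv ⁻¹' ball (planeEquiv x) r = osq x r := by
  ext y
  simp [planeEquiv_apply, osq, Prod.dist_eq, Real.dist_eq, Fin.forall_fin_two]

theorem isOpen_osq (x : E2) (r : ℝ) : IsOpen (osq x r) :=
  planeEquiv_preimage_ball x ▸ isOpen_ball.preimage planeEquiv.continuous

theorem isClosed_csq (x : E2) (r : ℝ) : IsClosed (csq x r) :=
  planeEquiv_preimage_closedBall x ▸ isClosed_closedBall.preimage planeEquiv.continuous

namespace BVMap

theorem integrable_g_apply {Ω : Set E2} (F : BVMap Ω) (v : E2) (i : Fin 2) :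
    Integrable (fun x => F.g x v i) F.var := by
  have := F.var_finite
  have hm : AEStronglyMeasurable (fun x => F.g x v i) F.var :=
    ((EuclideanSpace.proj (𝕜 := ℝ) i).comp
      (ContinuousLinearMap.apply ℝ E2 v)).continuous.comp_aestronglyMeasurable F.g_meas
  refine Integrable.of_bound hm ‖v‖ ?_
  filter_upwards [F.g_norm] with x hx
  calc ‖F.g x v i‖ ≤ ‖F.g x v‖ := PiLp.norm_apply_le _ i
    _ ≤ ‖F.g x‖ * ‖v‖ := (F.g x).le_opNorm v
    _ = ‖v‖ := by rw [hx, one_mul]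

theorem isWeakGradient (F : BVMap Q01) (i : Fin 2) :
    IsWeakGradient (planeEquiv.symm ⁻¹' Q01) (F.var.map planeEquiv)
      (fun p => Q01.indicator (fun x => F.f x i) (planeEquiv.symm p))
      (fun p => F.g (planeEquiv.symm p) (EuclideanSpace.single 0 1) i)
      (fun p => F.g (planeEquiv.symm p) (EuclideanSpace.single 1 1) i) := by
  have hQ : MeasurableSet Q01 := (isOpen_osq 0 1).measurableSet
  have hint : ∀ j : Fin 2, Integrable
      (fun p => F.g (planeEquiv.symm p) (EuclideanSpace.single j 1) i)
      (F.var.map planeEquiv) := by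
    intro j
    rw [measurableEmbedding_planeEquiv.integrable_map_iff]
    simpa [Function.comp_def] using F.integrable_g_apply (EuclideanSpace.single j 1) i
  have hparts : ∀ (j : Fin 2) (q : ℝ × ℝ), planeEquiv (EuclideanSpace.single j 1) = q →
      ∀ φ : ℝ × ℝ → ℝ, ContDiff ℝ 1 φ → HasCompactSupport φ →
        tsupport φ ⊆ planeEquiv.symm ⁻¹' Q01 →
        ∫ p, Q01.indicator (fun x => F.f x i) (planeEquiv.symm p) * fderiv ℝ φ p q
          = -∫ p, φ p * F.g (planeEquiv.symm p) (EuclideanSpace.single j 1) i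
            ∂F.var.map planeEquiv := by
    rintro j q rfl φ hφ hφc hφs
    have hts : tsupport (φ ∘ planeEquiv) ⊆ Q01 := by
      have h := tsupport_comp_eq_preimage φ planeEquiv.toHomeomorph
      intro x hx
      have hx' : x ∈ planeEquiv ⁻¹' tsupport φ := h ▸ hx
      simpa using hφs hx'
    have key := F.int_by_parts (φ ∘ planeEquiv) (hφ.comp planeEquiv.contDiff)
      (hφc.comp_homeomorph planeEquiv.toHomeomorph) hts i j
    rw [measurableEmbedding_planeEquiv.integral_map,
      ← measurePreserving_planeEquiv.integral_comp measurableEmbedding_planeEquiv]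
    simp only [ContinuousLinearEquiv.symm_apply_apply]
    rw [← integral_indicator hQ] at key
    refine Eq.trans (integral_congr_ae (ae_of_all _ fun x => ?_)) key
    by_cases hx : x ∈ Q01 <;> simp [hx, planeEquiv.comp_right_fderiv]
  refine ⟨?_, hint 0, hint 1, hparts 0 _ (by ext <;> simp [planeEquiv_apply]),
    hparts 1 _ (by ext <;> simp [planeEquiv_apply])⟩
  rw [← measurePreserving_planeEquiv.integrable_comp_emb measurableEmbedding_planeEquiv]
  have hfi : IntegrableOn (fun x => F.f x i) Q01 :=
    (EuclideanSpace.proj (𝕜 := ℝ) i).integrable_comp F.integrable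
  simpa [Function.comp_def] using (integrable_indicator_iff hQ).2 hfi

/-- Alberti's rank-one theorem for planar `BV` maps, in terms of the determinant. -/
theorem ae_varS_det_eq_zero (F : BVMap Q01) :
    ∀ᵐ x ∂F.varS, F.g x (EuclideanSpace.single 0 1) 0 * F.g x (EuclideanSpace.single 1 1) 1
      - F.g x (EuclideanSpace.single 1 1) 0 * F.g x (EuclideanSpace.single 0 1) 1 = 0 := by
  have := F.var_finite
  obtain ⟨N, hN, hSN, hvol⟩ := Measure.mutuallySingular_singularPart F.var volume
  have hNc : volume (planeEquiv.symm ⁻¹' Nᶜ) = 0 := by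
    rw [← measurePreserving_planeEquiv.measure_preimage_emb measurableEmbedding_planeEquiv]
    simpa [← preimage_comp] using hvol
  have hNm : MeasurableSet (planeEquiv.symm ⁻¹' Nᶜ) :=
    planeEquiv.symm.continuous.measurable hN.compl
  have hΩ : IsOpen (planeEquiv.symm ⁻¹' Q01) :=
    (isOpen_osq 0 1).preimage planeEquiv.symm.continuous
  have hdet := (F.isWeakGradient 0).ae_det_eq_zero hΩ (F.isWeakGradient 1) hNm hNc
  rw [ae_restrict_iff' hNm, measurableEmbedding_planeEquiv.ae_map_iff] at hdet
  have hle : F.varS ≪ F.var := (Measure.singularPart_le _ _).absolutelyContinuous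
  have hN' : ∀ᵐ x ∂F.varS, x ∈ Nᶜ := measure_eq_zero_iff_ae_notMem.1 hSN
  have hQ : ∀ᵐ x ∂F.var, x ∈ Q01 := by
    simpa using measure_eq_zero_iff_ae_notMem.1 F.var_outside
  filter_upwards [hle.ae_le hdet, hN', hle.ae_le hQ] with x hx hxN hxQ
  simpa using hx (by simpa using hxN) (by simpa using hxQ)

end BVMap

theorem ContinuousLinearMap.apply_eq_of_single (T : E2 →L[ℝ] E2) (x : E2) (k : Fin 2) :
    T x k = x 0 * T (EuclideanSpace.single 0 1) k + x 1 * T (EuclideanSpace.single 1 1) k := by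
  have hx : x = x 0 • EuclideanSpace.single 0 (1 : ℝ) + x 1 • EuclideanSpace.single 1 (1 : ℝ) := by
    ext i
    fin_cases i <;> simp
  conv_lhs => rw [hx]
  simp

theorem exists_eq_tensor_of_norm_eq_one_of_det_eq_zero {T : E2 →L[ℝ] E2} (hT : ‖T‖ = 1)
    (hdet : T (EuclideanSpace.single 0 1) 0 * T (EuclideanSpace.single 1 1) 1
      - T (EuclideanSpace.single 1 1) 0 * T (EuclideanSpace.single 0 1) 1 = 0) :
    ∃ u v : E2, ‖u‖ = 1 ∧ ‖v‖ = 1 ∧ T = tensor u v := by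
  set A : E2 := T (EuclideanSpace.single 0 1) with hA
  set B : E2 := T (EuclideanSpace.single 1 1) with hB
  obtain ⟨q, hq, hqk⟩ : ∃ q : E2, q ≠ 0 ∧ ∀ k, q 0 * B k = q 1 * A k := by
    by_contra! hcon
    have hrow : ∀ i, pt (A i) (B i) = 0 := by
      intro i
      by_contra hi
      obtain ⟨k, hk⟩ := hcon _ hi
      refine hk ?_
      fin_cases i <;> fin_cases k <;> simp [pt] <;> linarith
    have hT0 : T = 0 := by
      ext x k
      have h0 : A k = 0 := by simpa [pt] using congrArg (fun p : E2 => p 0) (hrow k)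
      have h1 : B k = 0 := by simpa [pt] using congrArg (fun p : E2 => p 1) (hrow k)
      rw [T.apply_eq_of_single, ← hA, ← hB, h0, h1]
      simp
    simp [hT0] at hT
  set v : E2 := ‖q‖⁻¹ • q with hv
  have hv1 : ‖v‖ = 1 := norm_smul_inv_norm (𝕜 := ℝ) hq
  have hvk : ∀ k, v 0 * B k = v 1 * A k := fun k => by
    simp only [hv, PiLp.smul_apply, smul_eq_mul, mul_assoc, hqk k]
  have hvsq : v 0 ^ 2 + v 1 ^ 2 = 1 := by
    have h := EuclideanSpace.real_norm_sq_eq v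
    rw [hv1, Fin.sum_univ_two] at h
    linarith
  have hTv : T = tensor (T v) v := by
    ext x k
    have hinner : (tensor (T v) v) x k = (v 0 * x 0 + v 1 * x 1) * T v k := by
      simp [tensor, PiLp.inner_apply, mul_comm]
    rw [hinner, T.apply_eq_of_single x, T.apply_eq_of_single v, ← hA, ← hB]
    linear_combination (-(x 0 * A k) - x 1 * B k) * hvsq - x 0 * v 1 * hvk k + x 1 * v 0 * hvk k
  refine ⟨T v, v, ?_, hv1, hTv⟩
  have hnorm : ‖tensor (T v) v‖ = ‖v‖ * ‖T v‖ := by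
    rw [tensor, ContinuousLinearMap.norm_smulRight_apply, innerSL_apply_norm]
  rwa [← hTv, hT, hv1, one_mul, eq_comm] at hnorm

theorem volume_csq (x : E2) {r : ℝ} (hr : 0 ≤ r) : volume (csq x r) = ENNReal.ofReal (4 * r ^ 2) := by
  rw [← planeEquiv_preimage_closedBall,
    measurePreserving_planeEquiv.measure_preimage_emb measurableEmbedding_planeEquiv,
    ← Prod.mk.eta (p := planeEquiv x), ← closedBall_prod_same, Measure.volume_eq_prod,
    Measure.prod_prod, Real.volume_closedBall, Real.volume_closedBall,
    ← ENNReal.ofReal_mul (by positivity)]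
  congr 1
  ring

theorem ae_tendsto_lintegral_csq_enorm_sub_div {E : Type*} [NormedAddCommGroup E] {μ : Measure E2}
    [IsFiniteMeasure μ] {g : E2 → E} (hg : Integrable g μ) :
    ∀ᵐ x ∂μ, Tendsto (fun r => (∫⁻ y in csq x r, ‖g y - g x‖ₑ ∂μ) / μ (csq x r))
      (𝓝[>] 0) (𝓝 0) := by
  have hint : Integrable (fun p => g (planeEquiv.symm p)) (μ.map planeEquiv) := by
    rw [measurableEmbedding_planeEquiv.integrable_map_iff]
    simpa [Function.comp_def] using hg
  have h := (Besicovitch.vitaliFamily (μ.map planeEquiv)).ae_tendsto_lintegral_enorm_sub_div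
    hint.locallyIntegrable
  rw [measurableEmbedding_planeEquiv.ae_map_iff] at h
  filter_upwards [h] with x hx
  refine (hx.comp (Besicovitch.tendsto_filterAt _ (planeEquiv x))).congr fun r => ?_
  simp only [Function.comp_apply]
  rw [measurableEmbedding_planeEquiv.restrict_map, measurableEmbedding_planeEquiv.lintegral_map,
    measurableEmbedding_planeEquiv.map_apply, planeEquiv_preimage_closedBall]
  simp

theorem ae_tendsto_measure_csq_div {μ : Measure E2} [IsFiniteMeasure μ]
    (hμ : Measure.MutuallySingular μ volume) :
    ∀ᵐ x ∂μ, Tendsto (fun r => μ (csq x r) / volume (csq x r)) (𝓝[>] 0) (𝓝 ⊤) := by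
  have hsing : Measure.MutuallySingular volume (μ.map planeEquiv) := by
    obtain ⟨N, hN, hμN, hvol⟩ := hμ
    refine ⟨planeEquiv.symm ⁻¹' Nᶜ, planeEquiv.symm.continuous.measurable hN.compl, ?_, ?_⟩
    · rw [← measurePreserving_planeEquiv.measure_preimage_emb measurableEmbedding_planeEquiv]
      simpa [← preimage_comp] using hvol
    · rw [measurableEmbedding_planeEquiv.map_apply]
      simpa [← preimage_comp] using hμN
  have h := (Besicovitch.ae_tendsto_rnDeriv volume (μ.map planeEquiv)).and
    hsing.rnDeriv_ae_eq_zero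
  rw [measurableEmbedding_planeEquiv.ae_map_iff] at h
  filter_upwards [h] with x ⟨hx, hx0⟩
  rw [hx0, Pi.zero_apply] at hx
  have hinv := ((continuous_inv (G := ℝ≥0∞)).tendsto 0).comp hx
  rw [ENNReal.inv_zero] at hinv
  refine hinv.congr' ?_
  filter_upwards [self_mem_nhdsWithin] with r hr
  have hr' : 0 < r := hr
  have hvol : volume (closedBall (planeEquiv x) r) = volume (csq x r) := by
    rw [← planeEquiv_preimage_closedBall,
      measurePreserving_planeEquiv.measure_preimage_emb measurableEmbedding_planeEquiv]
  simp only [Function.comp_apply]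
  rw [measurableEmbedding_planeEquiv.map_apply, planeEquiv_preimage_closedBall, hvol,
    ENNReal.inv_div (Or.inl (measure_ne_top _ _))]
  refine Or.inr ?_
  rw [volume_csq x hr'.le]
  exact (ENNReal.ofReal_pos.2 (by positivity)).ne'

namespace BVMap

theorem ae_varS_mem_Sset (F : BVMap Q01) : ∀ᵐ x ∂F.varS, x ∈ Sset F := by
  have := F.var_finite
  have : IsFiniteMeasure F.varS := inferInstanceAs (IsFiniteMeasure (F.var.singularPart volume))
  have hle : F.varS ≤ F.var := Measure.singularPart_le _ _
  have hQ : ∀ᵐ x ∂F.var, x ∈ Q01 := by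
    simpa using measure_eq_zero_iff_ae_notMem.1 F.var_outside
  have hsing : Measure.MutuallySingular F.varS volume :=
    Measure.mutuallySingular_singularPart F.var volume
  filter_upwards [hle.absolutelyContinuous.ae_le hQ, ae_tendsto_measure_csq_div hsing]
    with x hxQ hx
  refine ⟨hxQ, ?_⟩
  have h2 : Tendsto (fun r : ℝ => r / 2) (𝓝[>] 0) (𝓝[>] 0) := by
    refine tendsto_nhdsWithin_iff.2 ⟨?_, ?_⟩
    · exact ((continuous_id.div_const 2).tendsto' (0 : ℝ) 0 (by simp)).mono_left
        nhdsWithin_le_nhds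
    · filter_upwards [self_mem_nhdsWithin] with r hr
      exact half_pos (mem_Ioi.1 hr)
  refine tendsto_nhds_top_mono (hx.comp h2) ?_
  filter_upwards [self_mem_nhdsWithin] with r hr
  have hr' : 0 < r := hr
  simp only [Function.comp_apply]
  rw [volume_csq x (by positivity), show 4 * (r / 2) ^ 2 = r ^ 2 by ring]
  have hsub : csq x (r / 2) ⊆ osq x r := fun y hy i => (hy i).trans_lt (half_lt_self hr')
  gcongr

theorem ae_varS_tendsto_lintegral_csq (F : BVMap Q01) :
    ∀ᵐ x ∂F.varS, Tendsto
      (fun r => (∫⁻ y in csq x r, ‖F.g y - F.g x‖ₑ ∂F.varS) / F.varS (csq x r))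
      (𝓝[>] 0) (𝓝 0) := by
  have := F.var_finite
  have : IsFiniteMeasure F.varS := inferInstanceAs (IsFiniteMeasure (F.var.singularPart volume))
  have hle : F.varS ≤ F.var := Measure.singularPart_le _ _
  have hg : Integrable F.g F.var :=
    Integrable.of_bound F.g_meas 1 (F.g_norm.mono fun x hx => hx.le)
  exact ae_tendsto_lintegral_csq_enorm_sub_div (hg.mono_measure hle)

/-- Alberti's rank-one theorem for planar `BV` maps. -/
theorem ae_varS_exists_eq_tensor (F : BVMap Q01) :
    ∀ᵐ x ∂F.varS, ∃ u v : E2, ‖u‖ = 1 ∧ ‖v‖ = 1 ∧ F.g x = tensor u v := by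
  have hle : F.varS ≤ F.var := Measure.singularPart_le _ _
  filter_upwards [hle.absolutelyContinuous.ae_le F.g_norm, F.ae_varS_det_eq_zero] with x h1 h2
  exact exists_eq_tensor_of_norm_eq_one_of_det_eq_zero h1 h2

end BVMap

theorem exists_mem_dySq (K : ℕ) {x : E2} (hx : x ∈ Q01) : ∃ a b, x ∈ dySq K a b := by
  have key : ∀ t : ℝ, |t| < 1 →
      ∃ a : Fin (2 ^ K), |t - (-1 + (2 * (a : ℝ) + 1) * (2 : ℝ) ^ (-(K : ℤ)))|
        ≤ (2 : ℝ) ^ (-(K : ℤ)) := by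
    intro t ht
    obtain ⟨ht1, ht2⟩ := abs_lt.1 ht
    have h2 : (0 : ℝ) < 2 ^ K := by positivity
    set s := (t + 1) / 2 * 2 ^ K with hs
    have hs0 : 0 ≤ s := by positivity [show 0 ≤ t + 1 by linarith]
    have hs1 : s < 2 ^ K := by
      rw [hs]
      exact mul_lt_of_lt_one_left h2 (by linarith)
    refine ⟨⟨⌊s⌋₊, (Nat.floor_lt hs0).2 (by exact_mod_cast hs1)⟩, ?_⟩
    have ht : t = -1 + 2 * s * (2 : ℝ) ^ (-(K : ℤ)) := by
      rw [zpow_neg, zpow_natCast, hs]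
      field_simp
      ring
    have hpos : (0 : ℝ) < (2 : ℝ) ^ (-(K : ℤ)) := by positivity
    rw [ht, show ∀ a h : ℝ, -1 + 2 * s * h - (-1 + (2 * a + 1) * h) = (2 * (s - a) - 1) * h by
      intros; ring, abs_mul, abs_of_pos hpos]
    refine mul_le_of_le_one_left hpos.le (abs_le.2 ⟨?_, ?_⟩)
    · linarith [Nat.floor_le hs0]
    · linarith [Nat.lt_floor_add_one s]
  have hx' : ∀ i, |x i| < 1 := fun i => by simpa using hx i
  obtain ⟨a, ha⟩ := key _ (hx' 0)
  obtain ⟨b, hb⟩ := key _ (hx' 1)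
  refine ⟨a, b, fun i => ?_⟩
  fin_cases i
  · simpa [dyCenter, pt] using ha
  · simpa [dyCenter, pt] using hb

/-- The `K`-dyadic square with indices `a`, `b` contains a point of `S` at which the polar density
is rank one and around which it oscillates little. -/
def HasRankOnePoint (F : BVMap Q01) (ε : ℝ) (K : ℕ) (a b : Fin (2 ^ K)) : Prop :=
  ∃ w ∈ dySq K a b ∩ Sset F,
    (∫⁻ z in Sset F ∩ csq (dyCenter K a b) (2 * (2 : ℝ) ^ (-(K : ℤ))),
        ‖F.g z - F.g w‖₊ ∂F.varS)
      ≤ ENNReal.ofReal ε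
          * F.varS (csq (dyCenter K a b) (4 * (2 : ℝ) ^ (-(K : ℤ))) ∩ Sset F) ∧
    ∃ u v : E2, ‖u‖ = 1 ∧ ‖v‖ = 1 ∧ F.g w = tensor u v

theorem ae_varS_eventually_hasRankOnePoint (F : BVMap Q01) {ε : ℝ} (hε : 0 < ε) :
    ∀ᵐ x ∂F.varS, ∀ᶠ K in atTop, ∀ a b, x ∈ dySq K a b → HasRankOnePoint F ε K a b := by
  have := F.var_finite
  have : IsFiniteMeasure F.varS := inferInstanceAs (IsFiniteMeasure (F.var.singularPart volume))
  filter_upwards [F.ae_varS_mem_Sset, F.ae_varS_tendsto_lintegral_csq,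
    F.ae_varS_exists_eq_tensor] with x hxS hxL hxT
  have hK : Tendsto (fun K : ℕ => 3 * (2 : ℝ) ^ (-(K : ℤ))) atTop (𝓝[>] 0) := by
    refine tendsto_nhdsWithin_iff.2 ⟨?_, Eventually.of_forall fun K => mem_Ioi.2 (by positivity)⟩
    simpa [zpow_neg] using (tendsto_pow_atTop_nhds_zero_of_lt_one (r := (2 : ℝ)⁻¹) (by norm_num)
        (by norm_num)).const_mul 3
  filter_upwards [(hxL.comp hK).eventually_le_const (ENNReal.ofReal_pos.2 hε)] with K hKε a b hab
  refine ⟨x, ⟨hab, hxS⟩, ?_, hxT⟩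
  set h := (2 : ℝ) ^ (-(K : ℤ))
  set c := dyCenter K a b
  have hab' : ∀ i, |x i - c i| ≤ h := hab
  have hsub₁ : csq c (2 * h) ⊆ csq x (3 * h) := fun y hy i => by
    have := abs_sub_le (y i) (c i) (x i)
    have := hy i
    have := hab' i
    rw [abs_sub_comm] at this
    linarith
  have hsub₂ : csq x (3 * h) ⊆ csq c (4 * h) := fun y hy i => by
    have := abs_sub_le (y i) (x i) (c i)
    have := hy i
    have := hab' i
    linarith
  calc ∫⁻ z in Sset F ∩ csq c (2 * h), ‖F.g z - F.g x‖₊ ∂F.varS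
      ≤ ∫⁻ z in csq x (3 * h), ‖F.g z - F.g x‖ₑ ∂F.varS :=
        lintegral_mono_set (inter_subset_right.trans hsub₁)
    _ ≤ ENNReal.ofReal ε * F.varS (csq x (3 * h)) := by
        rcases eq_or_ne (F.varS (csq x (3 * h))) 0 with h0 | h0
        · rw [setLIntegral_measure_zero _ _ h0]
          exact zero_le
        · exact (ENNReal.div_le_iff h0 (measure_ne_top _ _)).1 hKε
    _ ≤ ENNReal.ofReal ε * F.varS (csq c (4 * h)) := by gcongr
    _ = ENNReal.ofReal ε * F.varS (csq c (4 * h) ∩ Sset F) := by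
        rw [measure_inter_conull (t := Sset F) F.ae_varS_mem_Sset]

/-- **Selection of the singular squares `E_{ε,K}`.**  In the setting of the dyadic
decomposition theorem (`f ∈ BV(Q(0,1))` an `NCBV` map, `ε > 0`, `F̃_ε` from the isolation
lemma, `0 < α ≤ α₀ < ε`, `K = K(ε,α)`, `F_{ε,K}` the dyadic squares near `F̃_ε`), there is
a subcollection `E_{ε,K}` of `F_{ε,K}`, with union `Ẽ_{ε,K}`, such that
`|D^s f|(Q(0,1) \ Ẽ_{ε,K}) ≤ 2ε |D^s f|(Q(0,1))`, and every `Q_i ∈ E_{ε,K}` contains a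
point `w_i ∈ Q_i ∩ S` with `∫_{S ∩ 2Q_i} |g(z) - g(w_i)| d|D^s f|(z) ≤ ε |D^s f|(4Q_i ∩ S)`,
where `g` is the polar density (`g|D^s f| = D^s f`) and `g(w_i) = u_i ⊗ v_i` is rank one
with unit `u_i`, `v_i`. -/
theorem singular_squares_selection (F : BVMap Q01) (hNC : NCBV F) (ε : ℝ) (hε : 0 < ε)
    (N₀ : ℕ) (c : Fin N₀ → E2) (rad : Fin N₀ → ℝ) (hrad : ∀ i, 0 < rad i)
    (Ftil : Set E2) (hFtil : Ftil = ⋃ i, osq (c i) (rad i))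
    (h1 : F.varA Ftil ≤ ENNReal.ofReal ε * F.varA Q01)
    (h2 : F.varS (Q01 \ Ftil) ≤ ENNReal.ofReal ε * F.varS Q01)
    (h3 : 0 < F.varA Q01 →
      F.varS (Q01 \ Ftil) ≤ ENNReal.ofReal (ε ^ 2) * F.varA Q01) :
    ∃ α₀ : ℝ, 0 < α₀ ∧ α₀ < ε ∧
      ∀ α : ℝ, 0 < α → α ≤ α₀ →
        ∃ K : ℕ, ∃ Ecoll : Fin (2 ^ K) → Fin (2 ^ K) → Prop,
          (∀ a b, Ecoll a b → InNearFam K Ftil a b) ∧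
          F.varS (Q01 \ ⋃ (a : Fin (2 ^ K)) (b : Fin (2 ^ K)) (_ : Ecoll a b), dySq K a b)
            ≤ ENNReal.ofReal (2 * ε) * F.varS Q01 ∧
          ∀ a b, Ecoll a b →
            ∃ w ∈ dySq K a b ∩ Sset F,
              (∫⁻ z in Sset F ∩ csq (dyCenter K a b) (2 * (2 : ℝ) ^ (-(K : ℤ))),
                  ‖F.g z - F.g w‖₊ ∂F.varS)
                ≤ ENNReal.ofReal ε
                    * F.varS (csq (dyCenter K a b) (4 * (2 : ℝ) ^ (-(K : ℤ))) ∩ Sset F) ∧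
              ∃ u v : E2, ‖u‖ = 1 ∧ ‖v‖ = 1 ∧ F.g w = tensor u v := by
  have := F.var_finite
  have : IsFiniteMeasure F.varS := inferInstanceAs (IsFiniteMeasure (F.var.singularPart volume))
  let U : ℕ → Set E2 := fun K => ⋃ (a : Fin (2 ^ K)) (b : Fin (2 ^ K))
    (_ : InNearFam K Ftil a b ∧ HasRankOnePoint F ε K a b), dySq K a b
  have hFm : MeasurableSet Ftil := hFtil ▸ MeasurableSet.iUnion fun i =>
    (isOpen_osq _ _).measurableSet
  have hUm : ∀ K, MeasurableSet (U K) := fun K =>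
    MeasurableSet.iUnion fun a => MeasurableSet.iUnion fun b => MeasurableSet.iUnion fun _ =>
      (isClosed_csq _ _).measurableSet
  have hQm : MeasurableSet Q01 := (isOpen_osq 0 1).measurableSet
  have hlim : Tendsto (fun K => F.varS ((Q01 ∩ Ftil) \ U K)) atTop (𝓝 0) := by
    rw [← measure_empty (μ := F.varS)]
    refine tendsto_measure_of_ae_tendsto_indicator_of_isFiniteMeasure atTop MeasurableSet.empty
      (fun K => (hQm.inter hFm).diff (hUm K)) ?_
    filter_upwards [ae_varS_eventually_hasRankOnePoint F hε] with x hx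
    filter_upwards [hx] with K hK
    refine iff_of_false (fun ⟨⟨hxQ, hxF⟩, hxU⟩ => hxU ?_) (notMem_empty x)
    obtain ⟨a, b, hab⟩ := exists_mem_dySq K hxQ
    simp only [U, mem_iUnion]
    exact ⟨a, b, ⟨Or.inl ⟨x, hab, hxF⟩, hK a b hab⟩, hab⟩
  obtain ⟨K, hK⟩ : ∃ K, F.varS ((Q01 ∩ Ftil) \ U K) ≤ ENNReal.ofReal ε * F.varS Q01 := by
    rcases eq_or_ne (F.varS Q01) 0 with h0 | h0
    · refine ⟨0, ?_⟩
      rw [measure_mono_null (sdiff_subset.trans inter_subset_left) h0]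
      exact zero_le
    · exact (hlim.eventually_le_const
        (ENNReal.mul_pos (ENNReal.ofReal_pos.2 hε).ne' h0)).exists
  refine ⟨ε / 2, half_pos hε, half_lt_self hε, fun α _ _ =>
    ⟨K, fun a b => InNearFam K Ftil a b ∧ HasRankOnePoint F ε K a b, fun a b h => h.1, ?_,
      fun a b h => h.2⟩⟩
  calc F.varS (Q01 \ U K)
      ≤ F.varS ((Q01 \ Ftil) ∪ ((Q01 ∩ Ftil) \ U K)) := by
        refine measure_mono fun x hx => ?_
        by_cases hxF : x ∈ Ftil
        · exact Or.inr ⟨⟨hx.1, hxF⟩, hx.2⟩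
        · exact Or.inl ⟨hx.1, hxF⟩
    _ ≤ ENNReal.ofReal ε * F.varS Q01 + ENNReal.ofReal ε * F.varS Q01 :=
        (measure_union_le _ _).trans (add_le_add h2 hK)
    _ = ENNReal.ofReal (2 * ε) * F.varS Q01 := by
        rw [← add_mul, ← ENNReal.ofReal_add hε.le hε.le, two_mul]
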